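/- There exists a constant C > 0 such that S(x, z) ≤ C·x uniformly for all real x ≥ 1 and z ≥ 1. -/

import Mathlib

open Finset MeasureTheory Filter

/-- `M(n, z) := ∑_{d ∣ n, d ≤ z} μ(d)`. -/
noncomputable def mobM (n : ℕ) (z : ℝ) : ℤ :=
  ∑ d ∈ n.divisors.filter (fun d : ℕ => (d : ℝ) ≤ z), ArithmeticFunction.moebius d

/-- `S(x, z) := ∑_{n ≤ x} M(n, z)²`. -/
noncomputable def Ssum (x z : ℝ) : ℝ :=
  ∑ n ∈ Finset.Icc 1 ⌊x⌋₊, ((mobM n z : ℝ)) ^ 2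

/-- `S(z) := ∑_{m, n ≤ z} μ(m) μ(n) / [m, n]`. -/
noncomputable def Sz (z : ℝ) : ℝ :=
  ∑ m ∈ Finset.Icc 1 ⌊z⌋₊, ∑ n ∈ Finset.Icc 1 ⌊z⌋₊,
    ((ArithmeticFunction.moebius m : ℝ) * (ArithmeticFunction.moebius n : ℝ)) / (Nat.lcm m n : ℝ)

/-- `f(n; iτ) := ∏_{p ∣ n} |1 - p^{-iτ}|²`. -/
noncomputable def fI (n : ℕ) (τ : ℝ) : ℝ :=
  ∏ p ∈ n.primeFactors, ‖(1 : ℂ) - (p : ℂ) ^ (-(τ * Complex.I))‖ ^ 2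

/-- `f(n; s) := ∏_{p ∣ n} |1 - p^{-s}|²` for complex `s`. -/
noncomputable def fC (n : ℕ) (s : ℂ) : ℝ :=
  ∏ p ∈ n.primeFactors, ‖(1 : ℂ) - (p : ℂ) ^ (-s)‖ ^ 2

/-- The constant `L`. -/
noncomputable def Lconst : ℝ :=
  (1 / (2 * Real.pi)) *
    ∫ τ : ℝ,
      (∏' p : Nat.Primes,
        (1 - 1 / ((p : ℕ) : ℝ)) * (1 + (fI (p : ℕ) τ - 1) / ((p : ℕ) : ℝ))) / τ ^ 2

/-- `𝓛(y) := exp{(log y)^{3/5} / (log log y)^{1/5}}`. -/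
noncomputable def curlyL (y : ℝ) : ℝ :=
  Real.exp ((Real.log y) ^ ((3 : ℝ) / 5) / (Real.log (Real.log y)) ^ ((1 : ℝ) / 5))

/-- `ψ(n) := ∏_{p ∣ n} (p + 1)`. -/
def psi (n : ℕ) : ℕ := ∏ p ∈ n.primeFactors, (p + 1)

/-- `ψ_m(n) := ∏_{p ∣ n, p ∤ m} (p + 1)`. -/
def psiM (m n : ℕ) : ℕ := ∏ p ∈ n.primeFactors.filter (fun p : ℕ => ¬ p ∣ m), (p + 1)

/-- `r(n) := ∏_{p ∣ n} (1 + 2/√p)`. -/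
noncomputable def rfun (n : ℕ) : ℝ := ∏ p ∈ n.primeFactors, (1 + 2 / Real.sqrt p)

/-- `k(n)`, the squarefree kernel of `n`. -/
def ker (n : ℕ) : ℕ := ∏ p ∈ n.primeFactors, p

/-- `T(y; m) := (6/π²) ∑_{d, t ≤ y} μ(d) μ(t) / ψ([d, t, m])`. -/
noncomputable def T (y : ℝ) (m : ℕ) : ℝ :=
  (6 / Real.pi ^ 2) *
    ∑ d ∈ Finset.Icc 1 ⌊y⌋₊, ∑ t ∈ Finset.Icc 1 ⌊y⌋₊,
      ((ArithmeticFunction.moebius d : ℝ) * (ArithmeticFunction.moebius t : ℝ)) /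
        (psi (Nat.lcm (Nat.lcm d t) m) : ℝ)

/-- The constant `L(m)`. -/
noncomputable def Lm (m : ℕ) : ℝ :=
  ((Nat.totient m : ℝ) ^ 2 / (2 * Real.pi * (m : ℝ) ^ 2 * (ker m : ℝ))) *
    ∫ τ : ℝ,
      (fI m τ *
        ∏' p : {p : Nat.Primes // ¬ ((p : ℕ) ∣ m)},
          (1 - 1 / ((p.1 : ℕ) : ℝ)) ^ 2 * (1 + fI (p.1 : ℕ) τ / ((p.1 : ℕ) : ℝ))) / τ ^ 2

/-- `B := ∏_p (1 - (3p + 1)/(p (p + 1)²))`. -/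
noncomputable def Bconst : ℝ :=
  ∏' p : Nat.Primes,
    (1 - (3 * ((p : ℕ) : ℝ) + 1) / (((p : ℕ) : ℝ) * (((p : ℕ) : ℝ) + 1) ^ 2))

/-- `α(n) := ∏_{p ∣ n} (1 - p/(p² + 3p + 1))`. -/
noncomputable def alpha (n : ℕ) : ℝ :=
  ∏ p ∈ n.primeFactors, (1 - (p : ℝ) / ((p : ℝ) ^ 2 + 3 * (p : ℝ) + 1))

namespace TruncatedMobius

/-- An antiderivative of `u ↦ log u * u ^ (-s)`. -/
noncomputable def logPowPrim (s : ℂ) (u : ℝ) : ℂ :=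
  (u : ℂ) ^ (1 - s) * (Real.log u / (1 - s) - 1 / (1 - s) ^ 2)

lemma hasDerivAt_logPowPrim {s : ℂ} (hs : s ≠ 1) {u : ℝ} (hu : 0 < u) :
    HasDerivAt (logPowPrim s) (Real.log u * (u : ℂ) ^ (-s)) u := by
  have h1 : HasDerivAt (fun u : ℝ => (u : ℂ) ^ (1 - s)) ((1 - s) * (u : ℂ) ^ (-s)) u := by
    have := hasDerivAt_ofReal_cpow_const hu.ne' (sub_ne_zero.2 hs.symm)
    rwa [show 1 - s - 1 = -s by ring] at this
  have h2 : HasDerivAt (fun u : ℝ => ((Real.log u : ℝ) : ℂ) / (1 - s) - 1 / (1 - s) ^ 2)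
      ((u⁻¹ : ℝ) / (1 - s)) u :=
    ((Real.hasDerivAt_log hu.ne').ofReal_comp.div_const _).sub_const _
  have h3 : (1 - s) ≠ 0 := sub_ne_zero.2 hs.symm
  refine (h1.mul h2).congr_deriv ?_
  have h4 : (u : ℂ) ^ (1 - s) = u * (u : ℂ) ^ (-s) := by
    rw [sub_eq_add_neg, Complex.cpow_add _ _ (by exact_mod_cast hu.ne'), Complex.cpow_one]
  have h5 : (u : ℂ) ≠ 0 := by exact_mod_cast hu.ne'
  rw [h4]
  push_cast
  field_simp
  ring

lemma hasDerivAt_log_mul_cpow (s : ℂ) {u : ℝ} (hu : 0 < u) :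
    HasDerivAt (fun u : ℝ => (Real.log u : ℂ) * (u : ℂ) ^ (-s))
      ((u : ℂ) ^ (-s - 1) * (1 - s * Real.log u)) u := by
  have h1 : HasDerivAt (fun u : ℝ => (u : ℂ) ^ (-s)) ((-s) * (u : ℂ) ^ (-s - 1)) u := by
    by_cases h : s = 0
    · subst h; simpa using hasDerivAt_const u (1 : ℂ)
    exact hasDerivAt_ofReal_cpow_const hu.ne' (neg_ne_zero.2 h)
  have h2 := (Real.hasDerivAt_log hu.ne').ofReal_comp
  refine (h2.mul h1).congr_deriv ?_
  have h5 : (u : ℂ) ≠ 0 := by exact_mod_cast hu.ne'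
  have h4 : (u : ℂ) ^ (-s) = u * (u : ℂ) ^ (-s - 1) := by
    conv_rhs => rw [← Complex.cpow_one (u : ℂ), Complex.cpow_one (u:ℂ)]
    rw [Complex.cpow_sub _ _ h5, Complex.cpow_one]
    field_simp
  rw [h4]
  push_cast
  field_simp
  ring

lemma one_add_log_le_two_mul_sqrt {u : ℝ} (hu : 1 ≤ u) :
    1 + Real.log u ≤ 2 * u ^ (1 / 2 : ℝ) := by
  have h0 : 0 < u := by linarith
  have := Real.log_le_sub_one_of_pos (Real.rpow_pos_of_pos h0 (1 / 2))
  rw [Real.log_rpow h0] at this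
  linarith

lemma norm_deriv_log_mul_cpow_le {s : ℂ} (hs : 1 ≤ s.re) {n u : ℝ} (hn : 1 ≤ n) (hu : n ≤ u) :
    ‖(u : ℂ) ^ (-s - 1) * (1 - s * Real.log u)‖ ≤ 2 * (1 + ‖s‖) * n ^ (-(3 / 2) : ℝ) := by
  have hu1 : 1 ≤ u := hn.trans hu
  have hu0 : 0 < u := by linarith
  have hl := Real.log_nonneg hu1
  rw [norm_mul, Complex.norm_cpow_eq_rpow_re_of_pos hu0]
  have h1 : u ^ (-s - 1).re ≤ u ^ (-2 : ℝ) :=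
    Real.rpow_le_rpow_of_exponent_le hu1 (by simp; linarith)
  have h2 : ‖(1 : ℂ) - s * Real.log u‖ ≤ (1 + ‖s‖) * (2 * u ^ (1 / 2 : ℝ)) := by
    calc _ ≤ ‖(1 : ℂ)‖ + ‖s * Real.log u‖ := norm_sub_le _ _
      _ = 1 + ‖s‖ * Real.log u := by
        rw [norm_mul, norm_one, Complex.norm_real, Real.norm_of_nonneg hl]
      _ ≤ (1 + ‖s‖) * (1 + Real.log u) := by nlinarith [norm_nonneg s]
      _ ≤ _ := by gcongr; exact one_add_log_le_two_mul_sqrt hu1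
  calc _ ≤ u ^ (-2 : ℝ) * ((1 + ‖s‖) * (2 * u ^ (1 / 2 : ℝ))) := by gcongr
    _ = 2 * (1 + ‖s‖) * (u ^ (-2 : ℝ) * u ^ (1 / 2 : ℝ)) := by ring
    _ = 2 * (1 + ‖s‖) * u ^ (-(3 / 2) : ℝ) := by rw [← Real.rpow_add hu0]; norm_num
    _ ≤ _ := by
      gcongr 2 * (1 + ‖s‖) * ?_
      exact Real.rpow_le_rpow_of_nonpos (by linarith) hu (by norm_num)

lemma norm_logPow_sub_le {s : ℂ} (hs : 1 < s.re) {n : ℕ} (hn : 1 ≤ n) :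
    ‖(Real.log ((n + 1 : ℕ) : ℝ) : ℂ) * (((n + 1 : ℕ) : ℝ) : ℂ) ^ (-s)
      - (logPowPrim s ((n + 1 : ℕ) : ℝ) - logPowPrim s n)‖
      ≤ 2 * (1 + ‖s‖) * (n : ℝ) ^ (-(3 / 2) : ℝ) := by
  have hs1 : s ≠ 1 := by rintro rfl; simp at hs
  have hn' : (1 : ℝ) ≤ n := by exact_mod_cast hn
  set K := 2 * (1 + ‖s‖) * (n : ℝ) ^ (-(3 / 2) : ℝ) with hK
  have hK0 : 0 ≤ K := by positivity
  set g : ℝ → ℂ := fun u : ℝ => (Real.log u : ℂ) * (u : ℂ) ^ (-s) with hg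
  set S := Set.Icc (n : ℝ) ((n + 1 : ℕ) : ℝ) with hS
  have hnn : (n : ℝ) ≤ ((n + 1 : ℕ) : ℝ) := by push_cast; linarith
  have hpos : ∀ u ∈ S, 0 < u := fun u hu => by linarith [hu.1]
  have hb : ((n + 1 : ℕ) : ℝ) ∈ S := ⟨hnn, le_rfl⟩
  have ha : (n : ℝ) ∈ S := ⟨le_rfl, hnn⟩
  have hdist : ∀ u ∈ S, ‖u - ((n + 1 : ℕ) : ℝ)‖ ≤ 1 := fun u hu => by
    have h1 := hu.1; have h2 := hu.2
    push_cast at *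
    rw [Real.norm_eq_abs, abs_le]; constructor <;> linarith
  have h1 : ∀ u ∈ S, ‖g u - g ((n + 1 : ℕ) : ℝ)‖ ≤ K := fun u hu => by
    have := (convex_Icc (n : ℝ) ((n + 1 : ℕ) : ℝ)).norm_image_sub_le_of_norm_hasDerivWithin_le
      (f := g) (C := K)
      (fun x hx => (hasDerivAt_log_mul_cpow s (hpos x hx)).hasDerivWithinAt)
      (fun x hx => norm_deriv_log_mul_cpow_le hs.le hn' hx.1) hb hu
    exact this.trans (mul_le_of_le_one_right hK0 (hdist u hu))
  have h2 := (convex_Icc (n : ℝ) ((n + 1 : ℕ) : ℝ)).norm_image_sub_le_of_norm_hasDerivWithin_le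
      (f := fun u : ℝ => logPowPrim s u - u * g ((n + 1 : ℕ) : ℝ)) (C := K)
      (f' := fun u => g u - 1 * g ((n + 1 : ℕ) : ℝ))
      (fun x hx => ((hasDerivAt_logPowPrim hs1 (hpos x hx)).sub
        ((hasDerivAt_id x).ofReal_comp.mul_const _)).hasDerivWithinAt)
      (fun x hx => by simpa using h1 x hx) hb ha
  have h3 := h2.trans (mul_le_of_le_one_right hK0 (hdist _ ha))
  refine le_of_eq_of_le ?_ h3
  congr 1
  simp only [hg]
  push_cast
  ring

lemma norm_logPowPrim_le {s : ℂ} (ht : 1 ≤ |s.im|) {u : ℝ} (hu : 1 ≤ u) :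
    ‖logPowPrim s u‖ ≤ u ^ (1 - s.re) * (1 + Real.log u) := by
  have hu0 : 0 < u := by linarith
  have hl := Real.log_nonneg hu
  have h1 : 1 ≤ ‖1 - s‖ := ht.trans (by simpa using Complex.abs_im_le_norm (1 - s))
  rw [logPowPrim, norm_mul, Complex.norm_cpow_eq_rpow_re_of_pos hu0]
  simp only [Complex.sub_re, Complex.one_re]
  gcongr
  calc _ ≤ ‖(Real.log u : ℂ) / (1 - s)‖ + ‖1 / (1 - s) ^ 2‖ := norm_sub_le _ _
    _ ≤ Real.log u + 1 := by
      rw [norm_div, norm_div, norm_pow, norm_one, Complex.norm_real, Real.norm_of_nonneg hl]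
      gcongr
      · exact div_le_self hl h1
      · exact div_le_self zero_le_one (one_le_pow₀ h1)
    _ = _ := add_comm _ _

lemma tendsto_logPowPrim {s : ℂ} (hs : 1 < s.re) (ht : 1 ≤ |s.im|) :
    Tendsto (fun n : ℕ => logPowPrim s n) atTop (nhds 0) := by
  have h0 : 0 < s.re - 1 := by linarith
  have h1 : Tendsto (fun u : ℝ => u ^ (1 - s.re) * (1 + Real.log u)) atTop (nhds 0) := by
    have ha := (isLittleO_log_rpow_atTop h0).tendsto_div_nhds_zero
    have hb := tendsto_rpow_neg_atTop h0
    have := hb.add ha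
    rw [add_zero] at this
    refine this.congr' ?_
    filter_upwards [eventually_gt_atTop 0] with u hu
    rw [neg_sub, div_eq_mul_inv, ← Real.rpow_neg hu.le, neg_sub]
    ring
  refine squeeze_zero_norm' ?_ (h1.comp tendsto_natCast_atTop_atTop)
  filter_upwards [eventually_ge_atTop 1] with n hn
  exact norm_logPowPrim_le ht (by exact_mod_cast hn)

lemma summable_log_mul_cpow {s : ℂ} (hs : 1 < s.re) :
    Summable (fun n : ℕ => (Real.log (n : ℝ) : ℂ) * (((n : ℕ) : ℝ) : ℂ) ^ (-s)) ∧
    deriv riemannZeta s = -∑' n : ℕ, (Real.log (n : ℝ) : ℂ) * (((n : ℕ) : ℝ) : ℂ) ^ (-s) := by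
  have habs : LSeries.abscissaOfAbsConv 1 < s.re := by
    rw [LSeries.abscissaOfAbsConv_one]; exact_mod_cast hs
  have h1 := LSeriesSummable_logMul_of_lt_re habs
  have heq : LSeries.term (LSeries.logMul 1) s =
      fun n : ℕ => (Real.log (n : ℝ) : ℂ) * (((n : ℕ) : ℝ) : ℂ) ^ (-s) := by
    funext n
    rcases eq_or_ne n 0 with rfl | hn
    · simp
    rw [LSeries.term_of_ne_zero hn, Complex.cpow_neg]
    simp [LSeries.logMul, div_eq_mul_inv]
  constructor
  · rw [← heq]; exact h1
  · rw [← heq]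
    have h2 := LSeries_deriv habs
    rw [← LSeries, ← h2]
    apply Filter.EventuallyEq.deriv_eq
    filter_upwards [(isOpen_lt continuous_const Complex.continuous_re).mem_nhds hs] with w hw
    exact (LSeries_one_eq_riemannZeta hw).symm

lemma norm_tsum_tail_le : ∃ C : ℝ, 0 < C ∧ ∀ s : ℂ, 1 < s.re → 1 ≤ |s.im| → ∀ N : ℕ, 1 ≤ N →
    ‖∑' n : ℕ, (Real.log ((n + (N + 1) : ℕ) : ℝ) : ℂ) * (((n + (N + 1) : ℕ) : ℝ) : ℂ) ^ (-s)‖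
      ≤ 1 + Real.log N + C * (1 + ‖s‖) * (N : ℝ) ^ (-(1 / 4) : ℝ) := by
  have hsum : Summable (fun n : ℕ => (n : ℝ) ^ (-(5 / 4) : ℝ)) :=
    Real.summable_nat_rpow.2 (by norm_num)
  refine ⟨2 * (1 + ∑' n : ℕ, (n : ℝ) ^ (-(5 / 4) : ℝ)), ?_, ?_⟩
  · have : 0 ≤ ∑' n : ℕ, (n : ℝ) ^ (-(5 / 4) : ℝ) := tsum_nonneg fun n => by positivity
    linarith
  intro s hs ht N hN
  have hN' : (1 : ℝ) ≤ N := by exact_mod_cast hN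
  have hN0 : (0 : ℝ) < N := by linarith
  set a : ℕ → ℂ := fun n => (Real.log (n : ℝ) : ℂ) * (((n : ℕ) : ℝ) : ℂ) ^ (-s) with ha
  have hasum : Summable a := (summable_log_mul_cpow hs).1
  have h1 : Summable (fun n => a (n + (N + 1))) := (summable_nat_add_iff (N + 1)).2 hasum
  set B : ℕ → ℝ := fun n => (2 * (1 + ‖s‖) * (N : ℝ) ^ (-(1 / 4) : ℝ)) * ((n + N : ℕ) : ℝ) ^ (-(5 / 4) : ℝ) with hB
  have hBs : Summable B := ((summable_nat_add_iff N).2 hsum).mul_left _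
  have hle : ∀ n, ‖a (n + (N + 1)) - (logPowPrim s ((n + 1 + N : ℕ) : ℝ) - logPowPrim s ((n + N : ℕ) : ℝ))‖ ≤ B n := by
    intro n
    have h := norm_logPow_sub_le hs (n := n + N) (by omega)
    rw [show n + N + 1 = n + (N + 1) by ring] at h
    rw [show n + 1 + N = n + (N + 1) by ring]
    refine h.trans ?_
    have hx : (N : ℝ) ≤ ((n + N : ℕ) : ℝ) := by push_cast; linarith [(Nat.cast_nonneg n : (0:ℝ) ≤ n)]
    have hx0 : (0 : ℝ) < ((n + N : ℕ) : ℝ) := by linarith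
    rw [show (-(3 / 2) : ℝ) = -(1 / 4) + -(5 / 4) by norm_num, Real.rpow_add hx0, ← mul_assoc]
    simp only [hB]
    gcongr 2 * (1 + ‖s‖) * ?_ * _
    exact Real.rpow_le_rpow_of_nonpos hN0 hx (by norm_num)
  have hds : Summable (fun n => a (n + (N + 1)) - (logPowPrim s ((n + 1 + N : ℕ) : ℝ) - logPowPrim s ((n + N : ℕ) : ℝ))) :=
    Summable.of_norm_bounded hBs hle
  have hd := tsum_of_norm_bounded hBs.hasSum hle
  have htel : ∑' n : ℕ, (logPowPrim s ((n + 1 + N : ℕ) : ℝ) - logPowPrim s ((n + N : ℕ) : ℝ)) = - logPowPrim s N := by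
    have hs2 : Summable (fun n : ℕ => (logPowPrim s ((n + 1 + N : ℕ) : ℝ) - logPowPrim s ((n + N : ℕ) : ℝ))) := by
      simpa using h1.sub hds
    refine tendsto_nhds_unique hs2.hasSum.tendsto_sum_nat ?_
    have h3 : Tendsto (fun n : ℕ => logPowPrim s ((n + N : ℕ) : ℝ) - logPowPrim s N) atTop (nhds (0 - logPowPrim s N)) :=
      (((tendsto_add_atTop_iff_nat N).2 (tendsto_logPowPrim hs ht))).sub_const _
    rw [zero_sub] at h3
    refine h3.congr fun n => ?_
    rw [Finset.sum_range_sub (fun n : ℕ => logPowPrim s ((n + N : ℕ) : ℝ))]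
    simp
  have hsplit : ∑' n, a (n + (N + 1)) = - logPowPrim s N +
      ∑' n, (a (n + (N + 1)) - (logPowPrim s ((n + 1 + N : ℕ) : ℝ) - logPowPrim s ((n + N : ℕ) : ℝ))) := by
    rw [← htel, ← Summable.tsum_add _ hds]
    · congr 1; funext n; ring
    · simpa using h1.sub hds
  change ‖∑' n, a (n + (N + 1))‖ ≤ _
  rw [hsplit]
  refine (norm_add_le _ _).trans ?_
  rw [norm_neg]
  gcongr
  · refine (norm_logPowPrim_le ht hN').trans ?_
    have := Real.log_nonneg hN'
    refine mul_le_of_le_one_left (by linarith) ?_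
    exact Real.rpow_le_one_of_one_le_of_nonpos hN' (by linarith)
  · refine hd.trans ?_
    simp only [hB]
    rw [tsum_mul_left]
    have : ∑' n : ℕ, ((n + N : ℕ) : ℝ) ^ (-(5 / 4) : ℝ) ≤ 1 + ∑' n : ℕ, (n : ℝ) ^ (-(5 / 4) : ℝ) := by
      have := hsum.sum_add_tsum_nat_add N
      have h0 : 0 ≤ ∑ i ∈ range N, (i : ℝ) ^ (-(5 / 4) : ℝ) := sum_nonneg fun i _ => by positivity
      linarith
    calc _ ≤ 2 * (1 + ‖s‖) * (N : ℝ) ^ (-(1 / 4) : ℝ) * (1 + ∑' n : ℕ, (n : ℝ) ^ (-(5 / 4) : ℝ)) := by gcongr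
      _ = _ := by ring

lemma exists_norm_deriv_riemannZeta_le : ∃ C : ℝ, 0 < C ∧ ∀ s : ℂ, 1 < s.re → s.re ≤ 2 →
    1 ≤ |s.im| → ‖deriv riemannZeta s‖ ≤ C * |s.im| ^ (1 / 40 : ℝ) := by
  obtain ⟨C, hC, h⟩ := norm_tsum_tail_le
  refine ⟨322 ^ 2 + 322 + C * 4, by positivity, fun s hs hs2 ht => ?_⟩
  set t := |s.im| with htdef
  have ht0 : 0 < t := by linarith
  set N := ⌈t ^ 4⌉₊ with hN
  have hN1 : t ^ 4 ≤ N := Nat.le_ceil _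
  have ht4 : 1 ≤ t ^ 4 := one_le_pow₀ ht
  have hN2 : (N : ℝ) ≤ 2 * t ^ 4 := by
    have := (Nat.ceil_lt_add_one (by positivity : 0 ≤ t ^ 4)).le
    linarith
  have hNr : (1 : ℝ) ≤ N := ht4.trans hN1
  have hN3 : 1 ≤ N := by exact_mod_cast hNr
  have hlog : 1 + Real.log N ≤ 322 * t ^ (1 / 80 : ℝ) := by
    have h1 : Real.log N ≤ Real.log 2 + 4 * Real.log t := by
      have := Real.log_le_log (by linarith) hN2
      rwa [Real.log_mul (by norm_num) (by positivity), Real.log_pow] at this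
    have h2 : Real.log t ≤ t ^ (1 / 80 : ℝ) / (1 / 80) := Real.log_le_rpow_div ht0.le (by norm_num)
    have h3 : 1 ≤ t ^ (1 / 80 : ℝ) := Real.one_le_rpow ht (by norm_num)
    have h4 := Real.log_two_lt_d9
    linarith
  have hlog0 := Real.log_nonneg hNr
  have hsq : t ^ (1 / 80 : ℝ) * t ^ (1 / 80 : ℝ) = t ^ (1 / 40 : ℝ) := by
    rw [← Real.rpow_add ht0]; norm_num
  have hle : t ^ (1 / 80 : ℝ) ≤ t ^ (1 / 40 : ℝ) :=
    Real.rpow_le_rpow_of_exponent_le ht (by norm_num)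
  have h1le : 1 ≤ t ^ (1 / 40 : ℝ) := Real.one_le_rpow ht (by norm_num)
  obtain ⟨hsum, hd⟩ := summable_log_mul_cpow hs
  rw [hd, norm_neg, ← hsum.sum_add_tsum_nat_add (N + 1)]
  refine (norm_add_le _ _).trans ?_
  have htail := h s hs ht N hN3
  have hns : ‖s‖ ≤ 2 + t := by
    refine (Complex.norm_le_abs_re_add_abs_im s).trans ?_
    rw [abs_of_pos (by linarith)]; gcongr
  have hNp : (N : ℝ) ^ (-(1 / 4) : ℝ) ≤ t⁻¹ := by
    calc (N : ℝ) ^ (-(1 / 4) : ℝ) ≤ (t ^ 4) ^ (-(1 / 4) : ℝ) :=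
          Real.rpow_le_rpow_of_nonpos (by linarith) hN1 (by norm_num)
      _ = t⁻¹ := by
        rw [← Real.rpow_natCast t 4, ← Real.rpow_mul ht0.le]
        norm_num [Real.rpow_neg_one]
  have h3 : C * (1 + ‖s‖) * (N : ℝ) ^ (-(1 / 4) : ℝ) ≤ C * 4 := by
    calc _ ≤ C * (4 * t) * t⁻¹ := by gcongr; linarith
      _ = C * 4 := by field_simp
  have hfin : ‖∑ n ∈ range (N + 1), (Real.log (n : ℝ) : ℂ) * (((n : ℕ) : ℝ) : ℂ) ^ (-s)‖
      ≤ (1 + Real.log N) * (1 + Real.log N) := by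
    refine (norm_sum_le _ _).trans ?_
    rw [sum_range_succ']
    simp only [Nat.cast_zero, Real.log_zero, Complex.ofReal_zero, zero_mul, norm_zero, add_zero]
    have h5 : ∀ n ∈ range N, ‖(Real.log ((n + 1 : ℕ) : ℝ) : ℂ) * ((((n + 1 : ℕ) : ℕ) : ℝ) : ℂ) ^ (-s)‖
        ≤ (1 + Real.log N) * (((n + 1 : ℕ) : ℝ))⁻¹ := by
      intro n hn
      have hn1 : (1 : ℝ) ≤ ((n + 1 : ℕ) : ℝ) := by push_cast; linarith [(Nat.cast_nonneg n : (0:ℝ) ≤ n)]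
      have hnN : ((n + 1 : ℕ) : ℝ) ≤ N := by
        have := mem_range.1 hn
        exact_mod_cast this
      rw [norm_mul, Complex.norm_real, Real.norm_of_nonneg (Real.log_nonneg hn1),
        Complex.norm_cpow_eq_rpow_re_of_pos (by linarith)]
      gcongr
      · have := Real.log_le_log (by linarith) hnN
        linarith
      · rw [← Real.rpow_neg_one]
        exact Real.rpow_le_rpow_of_exponent_le hn1 (by simp; linarith)
    refine (sum_le_sum h5).trans ?_
    rw [← mul_sum]
    gcongr
    have := harmonic_le_one_add_log N
    rw [harmonic] at this
    push_cast at this ⊢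
    exact this
  calc _ ≤ (1 + Real.log N) * (1 + Real.log N) + (1 + Real.log N + C * (1 + ‖s‖) * (N : ℝ) ^ (-(1 / 4) : ℝ)) := by
        gcongr
    _ ≤ (322 * t ^ (1 / 80 : ℝ)) * (322 * t ^ (1 / 80 : ℝ)) + (322 * t ^ (1 / 80 : ℝ) + C * 4) := by
        gcongr
    _ = 322 ^ 2 * t ^ (1 / 40 : ℝ) + (322 * t ^ (1 / 80 : ℝ) + C * 4 * 1) := by rw [← hsq]; ring
    _ ≤ 322 ^ 2 * t ^ (1 / 40 : ℝ) + (322 * t ^ (1 / 40 : ℝ) + C * 4 * t ^ (1 / 40 : ℝ)) := by gcongr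
    _ = _ := by ring

lemma norm_riemannZeta_sub_le_of_deriv {C t : ℝ}
    (h : ∀ s : ℂ, 1 < s.re → s.re ≤ 2 →
      1 ≤ |s.im| → ‖deriv riemannZeta s‖ ≤ C * |s.im| ^ (1 / 40 : ℝ)) (ht : 1 ≤ |t|)
    {x y : ℝ} (hx : 0 < x) (hx1 : x ≤ 1) (hy : 0 < y) (hy1 : y ≤ 1) :
    ‖riemannZeta (1 + x + Complex.I * t) - riemannZeta (1 + y + Complex.I * t)‖
      ≤ C * |t| ^ (1 / 40 : ℝ) * |x - y| := by
  set S : Set ℂ := {s | 1 < s.re ∧ s.re ≤ 2 ∧ s.im = t} with hS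
  have hconv : Convex ℝ S := by
    intro a ha b hb p q hp hq hpq
    simp only [hS, Set.mem_ofPred_eq, Complex.add_re, Complex.smul_re, Complex.add_im,
      Complex.smul_im, smul_eq_mul] at *
    refine ⟨?_, ?_, ?_⟩
    · rcases hp.eq_or_lt with rfl | hp
      · simp at hpq; subst hpq; simpa using hb.1
      · nlinarith [ha.1, hb.1]
    · nlinarith [ha.2.1, hb.2.1]
    · rw [ha.2.2, hb.2.2, ← add_mul, hpq, one_mul]
  have hmem : ∀ z : ℝ, 0 < z → z ≤ 1 → (1 + z + Complex.I * t : ℂ) ∈ S := by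
    intro z hz hz1
    simp [hS]
    constructor <;> linarith
  have := hconv.norm_image_sub_le_of_norm_hasDerivWithin_le (f := riemannZeta)
    (f' := deriv riemannZeta) (C := C * |t| ^ (1 / 40 : ℝ)) (fun w hw => ?_) (fun w hw => ?_)
    (hmem y hy hy1) (hmem x hx hx1)
  · refine this.trans (le_of_eq ?_)
    congr 1
    rw [show (1 + x + Complex.I * t - (1 + y + Complex.I * t) : ℂ) = ((x - y : ℝ) : ℂ) by
      push_cast; ring, Complex.norm_real, Real.norm_eq_abs]
  · have : w ≠ 1 := by rintro rfl; simp [hS] at hw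
    exact (differentiableAt_riemannZeta this).hasDerivAt.hasDerivWithinAt
  · have := h w hw.1 hw.2.1 (by rw [hw.2.2]; exact ht)
    rwa [hw.2.2] at this

lemma exists_norm_riemannZeta_le : ∃ C : ℝ, 0 < C ∧ ∀ x t : ℝ, 0 < x → x ≤ 1 →
    1 ≤ |t| → ‖riemannZeta (1 + x + Complex.I * t)‖ ≤ C * |t| ^ (1 / 40 : ℝ) := by
  obtain ⟨C, hC, h⟩ := exists_norm_deriv_riemannZeta_le
  have hs : Summable (fun n : ℕ => ‖1 / ((n : ℂ) + 1) ^ (2 : ℂ)‖) := by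
    have := (summable_nat_add_iff 1).2 (Real.summable_nat_rpow.2 (show (-2 : ℝ) < -1 by norm_num))
    refine this.congr fun n => ?_
    rw [norm_div, norm_one]
    have : ((n : ℂ) + 1) = (((n + 1 : ℕ) : ℝ) : ℂ) := by push_cast; ring
    rw [this, Complex.norm_cpow_eq_rpow_re_of_pos (by positivity), Real.rpow_neg (by positivity)]
    simp
  set A := ∑' n : ℕ, ‖1 / ((n : ℂ) + 1) ^ (2 : ℂ)‖ with hA
  have hA0 : 0 ≤ A := tsum_nonneg fun n => norm_nonneg _
  refine ⟨A + C, by positivity, fun x t hx hx1 ht => ?_⟩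
  have h2 : ‖riemannZeta (1 + (1 : ℝ) + Complex.I * t)‖ ≤ A := by
    rw [zeta_eq_tsum_one_div_nat_add_one_cpow (by simp)]
    have heq : ∀ n : ℕ, ‖1 / ((n : ℂ) + 1) ^ (1 + (1 : ℝ) + Complex.I * t : ℂ)‖
        = ‖1 / ((n : ℂ) + 1) ^ (2 : ℂ)‖ := by
      intro n
      have : ((n : ℂ) + 1) = (((n + 1 : ℕ) : ℝ) : ℂ) := by push_cast; ring
      rw [norm_div, norm_div, this, Complex.norm_cpow_eq_rpow_re_of_pos (by positivity),
        Complex.norm_cpow_eq_rpow_re_of_pos (by positivity)]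
      norm_num
    refine (norm_tsum_le_tsum_norm (by simpa only [heq] using hs)).trans ?_
    simp only [heq]
    exact le_rfl
  have h3 := norm_riemannZeta_sub_le_of_deriv h ht hx hx1 one_pos le_rfl
  have h4 : |x - 1| ≤ 1 := by rw [abs_le]; constructor <;> linarith
  have h5 : 1 ≤ |t| ^ (1 / 40 : ℝ) := Real.one_le_rpow ht (by norm_num)
  calc _ = ‖riemannZeta (1 + (1 : ℝ) + Complex.I * t) + (riemannZeta (1 + x + Complex.I * t) - riemannZeta (1 + (1 : ℝ) + Complex.I * t))‖ := by congr 1; ring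
    _ ≤ A + C * |t| ^ (1 / 40 : ℝ) * |x - 1| := (norm_add_le _ _).trans (add_le_add h2 h3)
    _ ≤ A * |t| ^ (1 / 40 : ℝ) + C * |t| ^ (1 / 40 : ℝ) * 1 := by
      gcongr
      exact le_mul_of_one_le_right hA0 h5
    _ = _ := by ring

lemma one_le_norm_riemannZeta_prod {x : ℝ} (hx : 0 < x) (t : ℝ) :
    1 ≤ ‖riemannZeta (1 + x)‖ ^ 3 * ‖riemannZeta (1 + x + Complex.I * t)‖ ^ 4 *
      ‖riemannZeta (1 + x + Complex.I * (2 * t : ℝ))‖ := by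
  have := DirichletCharacter.norm_LFunction_product_ge_one (1 : DirichletCharacter ℂ 1) hx t
  rw [DirichletCharacter.LFunctionTrivChar, DirichletCharacter.LFunction_modOne_eq,
    DirichletCharacter.LFunction_modOne_eq, norm_mul, norm_mul, norm_pow, norm_pow] at this
  convert this using 4
  push_cast; ring

lemma exists_norm_riemannZeta_real_le : ∃ C : ℝ, 0 < C ∧ ∀ x : ℝ, 0 < x → x ≤ 1 →
    ‖riemannZeta (1 + x)‖ ≤ C * x⁻¹ := by
  have hc : Continuous fun x : ℝ => riemannZeta₁ (1 + x) :=
    differentiable_riemannZeta₁.continuous.comp (by fun_prop)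
  obtain ⟨C, hC⟩ := (isCompact_Icc (a := (0 : ℝ)) (b := 1)).exists_bound_of_continuousOn hc.continuousOn
  refine ⟨max C 1, by positivity, fun x hx hx1 => ?_⟩
  have hne : (1 + x : ℂ) ≠ 1 := by
    intro h
    have : (x : ℂ) = 0 := by linear_combination h
    exact hx.ne' (by exact_mod_cast this)
  rw [riemannZeta_eq_inv_sub_mul hne, norm_mul, mul_comm]
  gcongr
  · exact (hC x ⟨hx.le, hx1⟩).trans (le_max_left _ _)
  · simp [abs_of_pos hx]

lemma exists_le_norm_riemannZeta : ∃ c : ℝ, 0 < c ∧ ∀ x t : ℝ, 0 < x → x ≤ 1 →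
    1 ≤ |t| → c * |t| ^ (-(1 / 10) : ℝ) ≤ ‖riemannZeta (1 + x + Complex.I * t)‖ := by
  obtain ⟨A, hA, hd⟩ := exists_norm_deriv_riemannZeta_le
  obtain ⟨B, hB, hz⟩ := exists_norm_riemannZeta_le
  obtain ⟨D, hD, hr⟩ := exists_norm_riemannZeta_real_le
  -- a lower bound away from the line `re s = 1`
  set K : ℝ := D ^ 3 * (B * 2 ^ (1 / 40 : ℝ)) with hK
  have hK0 : 0 < K := by positivity
  have hfar : ∀ x t : ℝ, 0 < x → x ≤ 1 → 1 ≤ |t| →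
      K ^ (-(1 / 4) : ℝ) * x ^ (3 / 4 : ℝ) * |t| ^ (-(1 / 160) : ℝ) ≤
        ‖riemannZeta (1 + x + Complex.I * t)‖ := by
    intro x t hx hx1 ht
    have ht0 : 0 < |t| := by linarith
    set Z := ‖riemannZeta (1 + x + Complex.I * t)‖
    have h2t : |2 * t| = 2 * |t| := by rw [abs_mul, abs_two]
    have h1 : 1 ≤ (D * x⁻¹) ^ 3 * Z ^ 4 * (B * (2 ^ (1 / 40 : ℝ) * |t| ^ (1 / 40 : ℝ))) := by
      refine (one_le_norm_riemannZeta_prod hx t).trans ?_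
      have := hz x (2 * t) hx hx1 (by rw [h2t]; linarith)
      rw [h2t, Real.mul_rpow (by norm_num) (abs_nonneg t)] at this
      gcongr
      exact hr x hx hx1
    have h2 : K⁻¹ * x ^ 3 * (|t| ^ (1 / 40 : ℝ))⁻¹ ≤ Z ^ 4 := by
      have e : (D * x⁻¹) ^ 3 * Z ^ 4 * (B * (2 ^ (1 / 40 : ℝ) * |t| ^ (1 / 40 : ℝ)))
          = Z ^ 4 * (K * (x ^ 3)⁻¹ * |t| ^ (1 / 40 : ℝ)) := by rw [hK]; field_simp
      rw [e] at h1
      rw [show K⁻¹ * x ^ 3 * (|t| ^ (1 / 40 : ℝ))⁻¹ = (K * (x ^ 3)⁻¹ * |t| ^ (1 / 40 : ℝ))⁻¹ by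
        field_simp]
      exact (inv_le_iff_one_le_mul₀ (by positivity)).2 h1
    refine le_of_pow_le_pow_left₀ (n := 4) (by norm_num) (norm_nonneg _) (le_of_eq_of_le ?_ h2)
    rw [mul_pow, mul_pow, ← Real.rpow_mul_natCast hK0.le, ← Real.rpow_mul_natCast hx.le,
      ← Real.rpow_mul_natCast ht0.le, ← Real.rpow_natCast x 3, ← Real.rpow_neg ht0.le,
      ← Real.rpow_neg_one]
    norm_num
  set k : ℝ := K ^ (-(1 / 4) : ℝ) with hk
  have hk0 : 0 < k := by positivity
  -- threshold constant
  set κ : ℝ := min 1 ((k / (2 * A)) ^ (4 : ℕ)) with hκ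
  have hκ0 : 0 < κ := by positivity
  have hκ1 : κ ≤ 1 := min_le_left _ _
  have hκ4 : A * κ ≤ k * κ ^ (3 / 4 : ℝ) / 2 := by
    have h1 : κ ^ (1 / 4 : ℝ) ≤ k / (2 * A) := by
      calc κ ^ (1 / 4 : ℝ) ≤ ((k / (2 * A)) ^ (4 : ℕ)) ^ (1 / 4 : ℝ) :=
            Real.rpow_le_rpow hκ0.le (min_le_right _ _) (by norm_num)
        _ = k / (2 * A) := by
          rw [← Real.rpow_natCast, ← Real.rpow_mul (by positivity)]; norm_num
    have h2 : κ = κ ^ (1 / 4 : ℝ) * κ ^ (3 / 4 : ℝ) := by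
      rw [← Real.rpow_add hκ0]; norm_num
    calc A * κ = A * (κ ^ (1 / 4 : ℝ) * κ ^ (3 / 4 : ℝ)) := by rw [← h2]
      _ ≤ A * (k / (2 * A) * κ ^ (3 / 4 : ℝ)) := by gcongr
      _ = _ := by field_simp
  refine ⟨k * κ ^ (3 / 4 : ℝ) / 2, by positivity, fun x t hx hx1 ht => ?_⟩
  have ht0 : 0 < |t| := by linarith
  set y := κ * |t| ^ (-(1 / 8) : ℝ) with hy
  have hy0 : 0 < y := by positivity
  have hy1 : y ≤ 1 := mul_le_one₀ hκ1 (by positivity)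
    (Real.rpow_le_one_of_one_le_of_nonpos ht (by norm_num))
  have hyv : k * y ^ (3 / 4 : ℝ) * |t| ^ (-(1 / 160) : ℝ) =
      k * κ ^ (3 / 4 : ℝ) * |t| ^ (-(1 / 10) : ℝ) := by
    rw [hy, Real.mul_rpow hκ0.le (by positivity), ← Real.rpow_mul ht0.le, mul_assoc, mul_assoc,
      mul_assoc, ← Real.rpow_add ht0]
    norm_num
  rcases le_total y x with hyx | hxy
  · refine le_trans ?_ (hfar x t hx hx1 ht)
    calc k * κ ^ (3 / 4 : ℝ) / 2 * |t| ^ (-(1 / 10) : ℝ)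
        ≤ k * κ ^ (3 / 4 : ℝ) * |t| ^ (-(1 / 10) : ℝ) := by
          gcongr; exact half_le_self (by positivity)
      _ = k * y ^ (3 / 4 : ℝ) * |t| ^ (-(1 / 160) : ℝ) := hyv.symm
      _ ≤ _ := by gcongr
  · have h1 := hfar y t hy0 hy1 ht
    rw [hyv] at h1
    have h2 := norm_riemannZeta_sub_le_of_deriv hd ht hy0 hy1 hx hx1
    have h3 : |y - x| ≤ y := by rw [abs_of_nonneg (by linarith)]; linarith
    have h4 : A * |t| ^ (1 / 40 : ℝ) * |y - x| ≤ k * κ ^ (3 / 4 : ℝ) / 2 * |t| ^ (-(1 / 10) : ℝ) := by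
      calc A * |t| ^ (1 / 40 : ℝ) * |y - x| ≤ A * |t| ^ (1 / 40 : ℝ) * y := by gcongr
        _ = A * κ * (|t| ^ (1 / 40 : ℝ) * |t| ^ (-(1 / 8) : ℝ)) := by rw [hy]; ring
        _ = A * κ * |t| ^ (-(1 / 10) : ℝ) := by rw [← Real.rpow_add ht0]; norm_num
        _ ≤ _ := by gcongr
    have h5 := norm_sub_norm_le (riemannZeta (1 + y + Complex.I * t))
      (riemannZeta (1 + x + Complex.I * t))
    linarith

/-- The derivative of `1 / ((s - 1) ζ(s))` is `O(|t| ^ (-3/4))` to the right of `re s = 1`. -/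
lemma exists_norm_deriv_inv_riemannZeta₁_le : ∃ C : ℝ, 0 < C ∧ ∀ x t : ℝ, 0 < x → x ≤ 1 → t ≠ 0 →
    ‖deriv (fun w => (riemannZeta₁ w)⁻¹) (1 + x + Complex.I * t)‖ ≤ C * |t| ^ (-(3 / 4) : ℝ) := by
  have hne : ∀ x t : ℝ, 0 ≤ x → riemannZeta₁ (1 + x + Complex.I * t) ≠ 0 := by
    intro x t hx
    by_cases h : (1 + x + Complex.I * t : ℂ) = 1
    · rw [h, riemannZeta₁_one]; exact one_ne_zero
    · intro h0
      have h1 := riemannZeta_eq_inv_sub_mul h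
      rw [h0, mul_zero] at h1
      exact riemannZeta_ne_zero_of_one_le_re (by simpa using hx) h1
  have hder : ∀ x t : ℝ, 0 ≤ x → deriv (fun w => (riemannZeta₁ w)⁻¹) (1 + x + Complex.I * t) =
      -deriv riemannZeta₁ (1 + x + Complex.I * t) / riemannZeta₁ (1 + x + Complex.I * t) ^ 2 := by
    intro x t hx
    exact ((differentiable_riemannZeta₁ _).hasDerivAt.inv (hne x t hx)).deriv
  -- near the real axis
  have hcont : ContinuousOn (fun p : ℝ × ℝ => -deriv riemannZeta₁ (1 + p.1 + Complex.I * p.2) /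
      riemannZeta₁ (1 + p.1 + Complex.I * p.2) ^ 2) (Set.Icc 0 1 ×ˢ Set.Icc (-1) 1) := by
    have hm : Continuous fun p : ℝ × ℝ => (1 + p.1 + Complex.I * p.2 : ℂ) := by fun_prop
    have hd1 : Continuous (deriv riemannZeta₁) :=
      (differentiable_riemannZeta₁.contDiff (n := 1)).continuous_deriv le_rfl
    refine ContinuousOn.div (hd1.comp hm).neg.continuousOn
      ((differentiable_riemannZeta₁.continuous.comp hm).pow 2).continuousOn ?_
    rintro ⟨x, t⟩ ⟨hx, -⟩
    exact pow_ne_zero _ (hne x t hx.1)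
  obtain ⟨E, hE⟩ := (isCompact_Icc.prod isCompact_Icc).exists_bound_of_continuousOn hcont
  obtain ⟨A, hA, hd⟩ := exists_norm_deriv_riemannZeta_le
  obtain ⟨B, hB, hz⟩ := exists_norm_riemannZeta_le
  obtain ⟨c, hc, hl⟩ := exists_le_norm_riemannZeta
  refine ⟨max E 1 + (B + A) / c ^ 2, by positivity, fun x t hx hx1 ht => ?_⟩
  have ht0 : 0 < |t| := abs_pos.2 ht
  rcases le_total |t| 1 with h1 | h1
  · rw [hder x t hx.le]
    have := hE (x, t) ⟨⟨hx.le, hx1⟩, abs_le.1 h1⟩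
    have h2 : 1 ≤ |t| ^ (-(3 / 4) : ℝ) := Real.one_le_rpow_of_pos_of_le_one_of_nonpos ht0 h1 (by norm_num)
    calc _ ≤ E := this
      _ ≤ (max E 1 + (B + A) / c ^ 2) * 1 := by
        have : E ≤ max E 1 := le_max_left _ _
        have : 0 ≤ (B + A) / c ^ 2 := by positivity
        linarith
      _ ≤ _ := by gcongr
  · rw [hder x t hx.le]
    set w : ℂ := 1 + x + Complex.I * t with hw
    have hw1 : w ≠ 1 := by
      intro h
      have := congrArg Complex.im h
      simp [hw] at this
      exact ht this
    have hsub : w - 1 ≠ 0 := sub_ne_zero.2 hw1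
    have e1 : riemannZeta₁ w = (w - 1) * riemannZeta w := by
      rw [riemannZeta_eq_inv_sub_mul hw1]; field_simp
    have e2 : deriv riemannZeta₁ w = riemannZeta w + (w - 1) * deriv riemannZeta w := by
      rw [deriv_riemannZeta_eq_neg_inv_sub_sq_mul_add hw1, riemannZeta_eq_inv_sub_mul hw1]
      field_simp; ring
    have hs : |t| ≤ ‖w - 1‖ := by
      have := Complex.abs_im_le_norm (w - 1)
      simpa [hw] using this
    have hs0 : 0 < ‖w - 1‖ := by linarith
    have hs1 : 1 ≤ ‖w - 1‖ := by linarith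
    have hζ := hz x t hx hx1 h1
    have hζ' := hd w (by simp [hw, hx]) (by simp [hw]; linarith) (by simpa [hw] using h1)
    have him : w.im = t := by simp [hw]
    rw [him] at hζ'
    have hlow := hl x t hx hx1 h1
    rw [norm_div, norm_neg, e2, norm_pow, e1, norm_mul]
    have hnum : ‖riemannZeta w + (w - 1) * deriv riemannZeta w‖ ≤
        ‖w - 1‖ * ((B + A) * |t| ^ (1 / 40 : ℝ)) := by
      refine (norm_add_le _ _).trans ?_
      rw [norm_mul]
      calc _ ≤ ‖w - 1‖ * (B * |t| ^ (1 / 40 : ℝ)) + ‖w - 1‖ * (A * |t| ^ (1 / 40 : ℝ)) := by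
            gcongr
            exact hζ.trans (le_mul_of_one_le_left (by positivity) hs1)
        _ = _ := by ring
    calc _ ≤ (‖w - 1‖ * ((B + A) * |t| ^ (1 / 40 : ℝ))) / (‖w - 1‖ * (c * |t| ^ (-(1 / 10) : ℝ))) ^ 2 := by
          gcongr
      _ = ‖w - 1‖⁻¹ * ((B + A) / c ^ 2) * (|t| ^ (1 / 40 : ℝ) / (|t| ^ (-(1 / 10) : ℝ)) ^ 2) := by
          field_simp
      _ ≤ |t|⁻¹ * ((B + A) / c ^ 2) * (|t| ^ (1 / 40 : ℝ) / (|t| ^ (-(1 / 10) : ℝ)) ^ 2) := by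
          gcongr
      _ = (B + A) / c ^ 2 * |t| ^ (-(31 / 40) : ℝ) := by
          rw [← Real.rpow_mul_natCast ht0.le, ← Real.rpow_sub ht0, ← Real.rpow_neg_one, mul_right_comm,
            ← Real.rpow_add ht0, mul_comm]
          norm_num
      _ ≤ (max E 1 + (B + A) / c ^ 2) * |t| ^ (-(3 / 4) : ℝ) := by
          have := Real.rpow_le_rpow_of_exponent_le h1 (show (-(31 / 40) : ℝ) ≤ -(3 / 4) by norm_num)
          gcongr
          exact le_add_of_nonneg_left (by positivity)

/-- The partial sums of `∑ μ(n) / n`. -/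
noncomputable def mobSum (y : ℝ) : ℝ :=
  ∑ n ∈ Ioc 0 ⌊y⌋₊, (ArithmeticFunction.moebius n : ℝ) / n

lemma abs_moebius_le_one_real (n : ℕ) : |(ArithmeticFunction.moebius n : ℝ)| ≤ 1 := by
  exact_mod_cast ArithmeticFunction.abs_moebius_le_one

lemma sum_moebius_mul_div {N : ℕ} (hN : 1 ≤ N) :
    ∑ n ∈ Ioc 0 N, (ArithmeticFunction.moebius n : ℝ) * ((N / n : ℕ) : ℝ) = 1 := by
  have := ArithmeticFunction.sum_Ioc_mul_zeta_eq_sum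
    (ArithmeticFunction.moebius : ArithmeticFunction ℤ) N
  rw [ArithmeticFunction.moebius_mul_coe_zeta] at this
  have h2 : ∑ n ∈ Ioc 0 N, (1 : ArithmeticFunction ℤ) n = 1 := by
    rw [Finset.sum_eq_single 1]
    · simp
    · intro b _ hb; exact ArithmeticFunction.one_apply_ne hb
    · intro h; exact absurd (mem_Ioc.2 ⟨by norm_num, hN⟩) h
  rw [h2] at this
  have h3 := congrArg (Int.cast (R := ℝ)) this
  simp only [Int.cast_sum, Int.cast_mul, Int.cast_natCast, Int.cast_one] at h3
  exact h3.symm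

lemma abs_mobSum_le_one (y : ℝ) : |mobSum y| ≤ 1 := by
  unfold mobSum
  set N := ⌊y⌋₊
  rcases Nat.eq_zero_or_pos N with h | h
  · simp [h]
  have h1 := sum_moebius_mul_div h
  have hN : (0 : ℝ) < N := by exact_mod_cast h
  have hmem : 1 ∈ Ioc 0 N := mem_Ioc.2 ⟨by norm_num, h⟩
  have h2 : |N * ∑ n ∈ Ioc 0 N, (ArithmeticFunction.moebius n : ℝ) / n - 1| ≤ N - 1 := by
    have e : N * ∑ n ∈ Ioc 0 N, (ArithmeticFunction.moebius n : ℝ) / n - 1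
        = ∑ n ∈ (Ioc 0 N).erase 1,
          (ArithmeticFunction.moebius n : ℝ) * ((N : ℝ) / n - ((N / n : ℕ) : ℝ)) := by
      conv_lhs => rw [← h1]
      rw [mul_sum, ← sum_sub_distrib, ← add_sum_erase _ _ hmem]
      simp only [Nat.cast_one, Nat.div_one, div_one]
      rw [mul_comm (N : ℝ) _, sub_self, zero_add]
      exact sum_congr rfl fun n _ => by ring
    rw [e]
    calc _ ≤ ∑ n ∈ (Ioc 0 N).erase 1, (1 : ℝ) := by
          refine (abs_sum_le_sum_abs _ _).trans (sum_le_sum fun n hn => ?_)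
          have hn0 : 0 < n := (mem_Ioc.1 (mem_of_mem_erase hn)).1
          have a1 : ((N / n : ℕ) : ℝ) ≤ (N : ℝ) / n := Nat.cast_div_le
          have a2 : (N : ℝ) / n < ((N / n : ℕ) : ℝ) + 1 := by
            rw [div_lt_iff₀ (by exact_mod_cast hn0)]
            exact_mod_cast (by simpa [mul_add, mul_comm] using Nat.lt_div_mul_add hn0 (a := N))
          rw [abs_mul]
          refine mul_le_one₀ (abs_moebius_le_one_real n) (abs_nonneg _) ?_
          rw [abs_le]; constructor <;> linarith
      _ = N - 1 := by
          rw [sum_const, card_erase_of_mem hmem]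
          simp [Nat.cast_sub h]
  have h3 : |N * ∑ n ∈ Ioc 0 N, (ArithmeticFunction.moebius n : ℝ) / n| ≤ N := by
    rw [abs_le] at h2 ⊢; constructor <;> linarith
  rw [abs_mul, abs_of_pos hN] at h3
  nlinarith

lemma integrableOn_mul_exp_neg {σ : ℝ} (hσ : 0 < σ) :
    IntegrableOn (fun v : ℝ => v * Real.exp (-(σ * v))) (Set.Ioi 0) := by
  have := integrableOn_rpow_mul_exp_neg_mul_rpow (p := 1) (s := 1) (b := σ) (by norm_num)
    (by norm_num) hσ
  simpa using this

lemma norm_mul_cexp_neg (s : ℂ) {v : ℝ} (hv : 0 ≤ v) :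
    ‖(v : ℂ) * Complex.exp (-(s * v))‖ = v * Real.exp (-(s.re * v)) := by
  rw [norm_mul, Complex.norm_exp, Complex.norm_of_nonneg hv]
  simp

lemma integrableOn_mul_cexp_neg {s : ℂ} (hs : 0 < s.re) {a : ℝ} (ha : 0 ≤ a) :
    IntegrableOn (fun v : ℝ => (v : ℂ) * Complex.exp (-(s * v))) (Set.Ioi a) := by
  have h := (integrableOn_mul_exp_neg hs).mono_set (Set.Ioi_subset_Ioi ha)
  refine Integrable.mono' h (by fun_prop) ?_
  filter_upwards [ae_restrict_mem measurableSet_Ioi] with v hv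
  exact (norm_mul_cexp_neg s (ha.trans (le_of_lt hv))).le

lemma integral_Ioi_mul_cexp_neg {s : ℂ} (hs : 0 < s.re) {a : ℝ} (ha : 0 ≤ a) :
    ∫ v in Set.Ioi a, (v : ℂ) * Complex.exp (-(s * v)) =
      Complex.exp (-(s * a)) * (a / s + 1 / s ^ 2) := by
  have hs0 : s ≠ 0 := by rintro rfl; simp at hs
  have hd : ∀ v ∈ Set.Ici a, HasDerivAt
      (fun v : ℝ => -(Complex.exp (-(s * v)) * (v / s + 1 / s ^ 2)))
      ((v : ℂ) * Complex.exp (-(s * v))) v := by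
    intro v _
    have h1 : HasDerivAt (fun v : ℝ => (v : ℂ)) 1 v := Complex.ofRealCLM.hasDerivAt
    have h2 := ((h1.const_mul s).neg.cexp.mul ((h1.div_const s).add_const (1 / s ^ 2))).neg
    refine h2.congr_deriv ?_
    simp only [mul_one, Pi.neg_apply]
    field_simp
    ring
  have ht : Tendsto (fun v : ℝ => -(Complex.exp (-(s * v)) * (v / s + 1 / s ^ 2))) atTop
      (nhds 0) := by
    rw [tendsto_zero_iff_norm_tendsto_zero]
    have h0 := tendsto_rpow_mul_exp_neg_mul_atTop_nhds_zero 1 s.re hs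
    have h1 := tendsto_rpow_mul_exp_neg_mul_atTop_nhds_zero 0 s.re hs
    have h2 := (h0.mul_const (1 / ‖s‖)).add (h1.mul_const (1 / ‖s‖ ^ 2))
    simp only [zero_mul, add_zero] at h2
    refine squeeze_zero' (Eventually.of_forall fun _ => norm_nonneg _) ?_ h2
    filter_upwards [eventually_ge_atTop 0] with v hv
    rw [norm_neg, norm_mul, Complex.norm_exp]
    have e : (-(s * (v : ℂ))).re = -s.re * v := by simp
    rw [e]
    calc _ ≤ Real.exp (-s.re * v) * (‖(v : ℂ) / s‖ + ‖1 / s ^ 2‖) := by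
          gcongr; exact norm_add_le _ _
      _ = _ := by
          simp only [norm_div, norm_pow, norm_one, Complex.norm_of_nonneg hv, Real.rpow_one,
            Real.rpow_zero]
          ring
  rw [integral_Ioi_of_hasDerivAt_of_tendsto' hd (integrableOn_mul_cexp_neg hs ha) ht]
  ring

/-- The contribution of `n` to the Laplace integral of `v ↦ v * mobSum (exp v)`. -/
noncomputable def laplaceTerm (s : ℂ) (n : ℕ) (v : ℝ) : ℂ :=
  (Set.Ici (Real.log n)).indicator
    (fun v : ℝ => ((ArithmeticFunction.moebius n : ℂ) / n) * (v * Complex.exp (-(s * v)))) v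

lemma integrable_laplaceTerm {s : ℂ} (hs : 0 < s.re) (n : ℕ) : Integrable (laplaceTerm s n) := by
  unfold laplaceTerm
  rw [integrable_indicator_iff measurableSet_Ici, integrableOn_Ici_iff_integrableOn_Ioi]
  exact (integrableOn_mul_cexp_neg hs (Real.log_natCast_nonneg n)).const_mul _

lemma integral_laplaceTerm {s : ℂ} (hs : 0 < s.re) (n : ℕ) :
    ∫ v, laplaceTerm s n v = ((ArithmeticFunction.moebius n : ℂ) / n) *
      (Complex.exp (-(s * Real.log n)) * (Real.log n / s + 1 / s ^ 2)) := by
  unfold laplaceTerm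
  rw [integral_indicator measurableSet_Ici, integral_Ici_eq_integral_Ioi, integral_const_mul,
    integral_Ioi_mul_cexp_neg hs (Real.log_natCast_nonneg n)]

lemma norm_laplaceTerm_le {s : ℂ} (n : ℕ) (v : ℝ) :
    ‖laplaceTerm s n v‖ = 
      (Set.Ici (Real.log n)).indicator
    (fun v : ℝ => (|(ArithmeticFunction.moebius n : ℝ)| / n) * (v * Real.exp (-(s.re * v)))) v := by
  unfold laplaceTerm
  by_cases hv : v ∈ Set.Ici (Real.log n)
  · rw [Set.indicator_of_mem hv, Set.indicator_of_mem hv, norm_mul,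
      norm_mul_cexp_neg s ((Real.log_natCast_nonneg n).trans hv)]
    simp
  · rw [Set.indicator_of_notMem hv, Set.indicator_of_notMem hv, norm_zero]

lemma integral_norm_laplaceTerm {s : ℂ} (hs : 0 < s.re) (n : ℕ) :
    ∫ v, ‖laplaceTerm s n v‖ = (|(ArithmeticFunction.moebius n : ℝ)| / n) *
      (Real.exp (-(s.re * Real.log n)) * (Real.log n / s.re + 1 / s.re ^ 2)) := by
  simp_rw [norm_laplaceTerm_le]
  rw [integral_indicator measurableSet_Ici, integral_Ici_eq_integral_Ioi, integral_const_mul]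
  congr 1
  have := integral_Ioi_mul_cexp_neg (s := (s.re : ℂ)) (by simpa using hs)
    (Real.log_natCast_nonneg n)
  rw [← Complex.ofReal_inj, ← integral_complex_ofReal]
  push_cast at this ⊢
  exact this

lemma summable_integral_norm_laplaceTerm {s : ℂ} (hs : 0 < s.re) :
    Summable fun n => ∫ v, ‖laplaceTerm s n v‖ := by
  simp_rw [integral_norm_laplaceTerm hs]
  have h1 := (summable_log_mul_cpow (s := 1 + s.re) (by simpa using hs)).1.norm
  have h2 : Summable fun n : ℕ => 1 / (n : ℝ) ^ (1 + s.re) :=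
    Real.summable_one_div_nat_rpow.2 (by linarith)
  refine Summable.of_nonneg_of_le (fun n => ?_) (fun n => ?_)
    ((h1.mul_right (1 / s.re)).add (h2.mul_right (1 / s.re ^ 2)))
  · have := Real.log_natCast_nonneg n
    positivity
  · rcases Nat.eq_zero_or_pos n with rfl | hn
    · simp; positivity
    have hn' : (0 : ℝ) < n := by exact_mod_cast hn
    have hl := Real.log_natCast_nonneg n
    have e1 : Real.exp (-(s.re * Real.log n)) / n = 1 / (n : ℝ) ^ (1 + s.re) := by
      rw [Real.rpow_add hn', Real.rpow_one, Real.rpow_def_of_pos hn', Real.exp_neg, mul_comm s.re]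
      field_simp
    have e2 : ‖(Real.log (n : ℝ) : ℂ) * (((n : ℕ) : ℝ) : ℂ) ^ (-(1 + (s.re : ℂ)))‖
        = Real.log n * (1 / (n : ℝ) ^ (1 + s.re)) := by
      rw [norm_mul, Complex.norm_of_nonneg hl, Complex.norm_cpow_eq_rpow_re_of_pos hn', one_div,
        ← Real.rpow_neg hn'.le]
      simp
    rw [e2]
    calc _ ≤ (1 / n) * (Real.exp (-(s.re * Real.log n)) * (Real.log n / s.re + 1 / s.re ^ 2)) := by
          gcongr
          exact abs_moebius_le_one_real n
      _ = (Real.exp (-(s.re * Real.log n)) / n) * (Real.log n / s.re + 1 / s.re ^ 2) := by ring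
      _ = _ := by rw [e1]; ring

lemma tsum_laplaceTerm (s : ℂ) (v : ℝ) :
    ∑' n, laplaceTerm s n v = (mobSum (Real.exp v) : ℂ) * (v * Complex.exp (-(s * v))) := by
  have key : ∀ n : ℕ, n ≠ 0 → (n ∈ Ioc 0 ⌊Real.exp v⌋₊ ↔ v ∈ Set.Ici (Real.log n)) := by
    intro n hn
    have hn' : (0 : ℝ) < n := by exact_mod_cast Nat.pos_of_ne_zero hn
    rw [mem_Ioc, Nat.le_floor_iff (Real.exp_pos v).le, Set.mem_Ici, Real.log_le_iff_le_exp hn']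
    simp [Nat.pos_of_ne_zero hn]
  rw [tsum_eq_sum (s := Ioc 0 ⌊Real.exp v⌋₊)]
  · unfold mobSum
    push_cast
    rw [sum_mul]
    refine sum_congr rfl fun n hn => ?_
    have hn0 : n ≠ 0 := (mem_Ioc.1 hn).1.ne'
    rw [laplaceTerm, Set.indicator_of_mem ((key n hn0).1 hn)]
  · intro n hn
    rcases eq_or_ne n 0 with rfl | hn0
    · simp [laplaceTerm]
    · rw [laplaceTerm, Set.indicator_of_notMem fun h => hn ((key n hn0).2 h)]

lemma inv_riemannZeta₁_eq {w : ℂ} (hw : 1 < w.re) :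
    (riemannZeta₁ w)⁻¹ = (w - 1)⁻¹ * LSeries (fun n => (ArithmeticFunction.moebius n : ℂ)) w := by
  have hne : w ≠ 1 := by rintro rfl; simp at hw
  have h1 := ArithmeticFunction.LSeries_zeta_mul_Lseries_moebius hw
  rw [ArithmeticFunction.LSeries_zeta_eq_riemannZeta hw, riemannZeta_eq_inv_sub_mul hne] at h1
  have h2 : riemannZeta₁ w ≠ 0 := by
    intro h; rw [h] at h1; simp at h1
  have h3 : w - 1 ≠ 0 := sub_ne_zero.2 hne
  rw [inv_eq_iff_eq_inv]
  rw [mul_assoc, mul_left_comm] at h1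
  exact eq_inv_of_mul_eq_one_left h1

lemma integral_mobSum_mul_cexp {s : ℂ} (hs : 0 < s.re) :
    ∫ v : ℝ, (mobSum (Real.exp v) : ℂ) * (v * Complex.exp (-(s * v))) =
      -deriv (fun w => (riemannZeta₁ w)⁻¹) (1 + s) := by
  have h := hasSum_integral_of_summable_integral_norm (fun n => integrable_laplaceTerm hs n)
    (summable_integral_norm_laplaceTerm hs)
  simp_rw [tsum_laplaceTerm, integral_laplaceTerm hs] at h
  have hre : 1 < (1 + s).re := by simpa using hs
  have hs0 : s ≠ 0 := by rintro rfl; simp at hs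
  have habs : LSeries.abscissaOfAbsConv (fun n => (ArithmeticFunction.moebius n : ℂ)) < (1 + s).re := by
    rw [ArithmeticFunction.abscissaOfAbsConv_moebius]
    exact_mod_cast hre
  have hd : deriv (fun w => (riemannZeta₁ w)⁻¹) (1 + s) =
      -(1 / s ^ 2) * LSeries (fun n => (ArithmeticFunction.moebius n : ℂ)) (1 + s) -
      s⁻¹ * LSeries (LSeries.logMul fun n => (ArithmeticFunction.moebius n : ℂ)) (1 + s) := by
    have e : (fun w => (riemannZeta₁ w)⁻¹) =ᶠ[nhds (1 + s)] fun w =>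
        (w - 1)⁻¹ * LSeries (fun n => (ArithmeticFunction.moebius n : ℂ)) w := by
      filter_upwards [(isOpen_lt continuous_const Complex.continuous_re).mem_nhds hre] with w hw
      exact inv_riemannZeta₁_eq hw
    rw [e.deriv_eq]
    have h1 : HasDerivAt (fun w : ℂ => (w - 1)⁻¹) (-1 / (1 + s - 1) ^ 2) (1 + s) :=
      ((hasDerivAt_id _).sub_const 1).fun_inv (by simpa using hs0)
    rw [(h1.fun_mul (LSeries_hasDerivAt habs)).deriv]
    simp only [add_sub_cancel_left]
    ring
  have hsum1 : LSeriesSummable (fun n => (ArithmeticFunction.moebius n : ℂ)) (1 + s) :=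
    LSeriesSummable_of_abscissaOfAbsConv_lt_re habs
  have hsum2 : LSeriesSummable (LSeries.logMul fun n => (ArithmeticFunction.moebius n : ℂ)) (1 + s) :=
    LSeriesSummable_logMul_of_lt_re habs
  have h3 := (hsum1.hasSum.mul_left (1 / s ^ 2)).add (hsum2.hasSum.mul_left s⁻¹)
  rw [hd]
  have e2 : ∀ n : ℕ, (ArithmeticFunction.moebius n : ℂ) / n *
      (Complex.exp (-(s * Real.log n)) * (Real.log n / s + 1 / s ^ 2)) =
      1 / s ^ 2 * LSeries.term (fun n => (ArithmeticFunction.moebius n : ℂ)) (1 + s) n +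
      s⁻¹ * LSeries.term (LSeries.logMul fun n => (ArithmeticFunction.moebius n : ℂ)) (1 + s) n := by
    intro n
    rcases eq_or_ne n 0 with rfl | hn
    · simp
    have hn' : (n : ℂ) ≠ 0 := by exact_mod_cast hn
    rw [LSeries.term_of_ne_zero hn, LSeries.term_of_ne_zero hn, LSeries.logMul,
      Complex.cpow_add _ _ hn', Complex.cpow_one,
      Complex.cpow_def_of_ne_zero hn' s, Complex.exp_neg, Complex.natCast_log,
      mul_comm s]
    field_simp
    ring
  simp_rw [e2] at h
  rw [h.unique h3]
  simp only [LSeries]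
  ring

lemma measurable_mobSum : Measurable mobSum :=
  (measurable_from_nat (f := fun N : ℕ => ∑ n ∈ Ioc 0 N,
    (ArithmeticFunction.moebius n : ℝ) / n)).comp Nat.measurable_floor

lemma mobSum_eq_zero {y : ℝ} (hy : y < 1) : mobSum y = 0 := by
  rw [mobSum, Nat.floor_eq_zero.2 hy]; simp

lemma integrable_mobSum_mul_cexp {s : ℂ} (hs : 0 < s.re) :
    Integrable fun v : ℝ => (mobSum (Real.exp v) : ℂ) * (v * Complex.exp (-(s * v))) := by
  have h1 := (integrable_indicator_iff measurableSet_Ioi).2 (integrableOn_mul_exp_neg hs)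
  refine h1.mono' ?_ (Eventually.of_forall fun v => ?_)
  · have : Measurable fun v : ℝ => (mobSum (Real.exp v) : ℂ) :=
      Complex.measurable_ofReal.comp (measurable_mobSum.comp Real.measurable_exp)
    exact (this.mul (by fun_prop)).aestronglyMeasurable
  · rcases le_or_gt v 0 with hv | hv
    · rw [Set.indicator_of_notMem (by simpa using hv)]
      rcases hv.lt_or_eq with hv | rfl
      · rw [mobSum_eq_zero (by simpa using hv)]; simp
      · simp
    · rw [Set.indicator_of_mem (by simpa using hv), norm_mul, norm_mul_cexp_neg s hv.le,
        Complex.norm_real]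
      exact mul_le_of_le_one_left (by positivity) (abs_mobSum_le_one _)

lemma integrable_abs_rpow_mul_exp_neg_mul_sq {b q : ℝ} (hb : 0 < b) (hq : -1 < q) :
    Integrable (fun x : ℝ => |x| ^ q * Real.exp (-b * x ^ 2)) := by
  have h1 : IntegrableOn (fun x : ℝ => |x| ^ q * Real.exp (-b * x ^ 2)) (Set.Ioi 0) := by
    refine (integrableOn_rpow_mul_exp_neg_mul_sq hb hq).congr_fun (fun x hx => ?_)
      measurableSet_Ioi
    simp only
    rw [abs_of_pos hx]
  rw [← integrableOn_univ, ← Set.Iic_union_Ioi (a := (0 : ℝ))]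
  refine IntegrableOn.union ?_ h1
  rw [integrableOn_Iic_iff_integrableOn_Iio]
  have := (Measure.measurePreserving_neg (volume : Measure ℝ)).integrableOn_comp_preimage
    (Homeomorph.neg ℝ).measurableEmbedding (f := fun x : ℝ => |x| ^ q * Real.exp (-b * x ^ 2))
    (s := Set.Ioi 0)
  have h2 := this.2 h1
  simpa [Function.comp_def] using h2

lemma integral_abs_rpow_mul_exp_neg_mul_sq {b q : ℝ} (hb : 0 < b) (hq : -1 < q) :
    ∫ x : ℝ, |x| ^ q * Real.exp (-b * x ^ 2) =
      b ^ (-(q + 1) / 2) * Real.Gamma ((q + 1) / 2) := by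
  have h := integral_comp_abs (f := fun x : ℝ => x ^ q * Real.exp (-b * x ^ 2))
  simp only [sq_abs] at h
  rw [h]
  have := integral_rpow_mul_exp_neg_mul_rpow (p := 2) (q := q) (b := b) (by norm_num) hq hb
  simp only [Real.rpow_ofNat] at this
  rw [this]
  ring

lemma integral_mul_gaussian_eq {f : ℝ → ℂ} (hf : Integrable f) (u : ℝ) {η : ℝ} (hη : 0 < η) :
    ∫ v, f v * ((1 / η * Real.exp (-Real.pi * ((v - u) / η) ^ 2) : ℝ) : ℂ) =
    ∫ ξ, (∫ v : ℝ, Complex.exp ((-2 * Real.pi * v * ξ : ℝ) * Complex.I) * f v) *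
      Complex.exp (-Real.pi * ((η ^ 2 : ℝ) : ℂ) * ξ ^ 2 + 2 * Real.pi * (Complex.I * u) * ξ) := by
  have hb : 0 < (((η ^ 2 : ℝ)) : ℂ).re := by
    rw [Complex.ofReal_re]; positivity
  have hg : Integrable fun ξ : ℝ =>
      Complex.exp (-Real.pi * ((η ^ 2 : ℝ) : ℂ) * ξ ^ 2 + 2 * Real.pi * (Complex.I * u) * ξ) := by
    have := integrable_cexp_quadratic (b := Real.pi * ((η ^ 2 : ℝ) : ℂ))
      (by rw [Complex.re_ofReal_mul]; exact mul_pos Real.pi_pos hb)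
      (2 * Real.pi * (Complex.I * u)) 0
    simpa using this
  have h := VectorFourier.integral_fourierIntegral_smul_eq_flip (L := innerₗ ℝ)
      Real.continuous_fourierChar continuous_inner hf hg
  have hG := fourier_gaussian_pi' hb (Complex.I * u)
  have e1 : ∀ ξ : ℝ, VectorFourier.fourierIntegral Real.fourierChar volume (innerₗ ℝ) f ξ =
      ∫ v : ℝ, Complex.exp ((-2 * Real.pi * v * ξ : ℝ) * Complex.I) * f v := by
    intro ξ
    have := Real.fourier_real_eq_integral_exp_smul f ξ
    simp only [smul_eq_mul] at this
    rw [← this]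
    rfl
  have e2 : ∀ v : ℝ, VectorFourier.fourierIntegral Real.fourierChar volume (innerₗ ℝ).flip
      (fun ξ : ℝ => Complex.exp (-Real.pi * ((η ^ 2 : ℝ) : ℂ) * ξ ^ 2
        + 2 * Real.pi * (Complex.I * u) * ξ)) v =
      ((1 / η * Real.exp (-Real.pi * ((v - u) / η) ^ 2) : ℝ) : ℂ) := by
    intro v
    have h3 := congrFun hG v
    rw [Real.fourier_real_eq] at h3
    have h4 : (((η ^ 2 : ℝ)) : ℂ) ^ (1 / 2 : ℂ) = (η : ℂ) := by
      have : (1 / 2 : ℂ) = ((1 / 2 : ℝ) : ℂ) := by push_cast; rfl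
      rw [this, ← Complex.ofReal_cpow (by positivity), ← Real.sqrt_eq_rpow, Real.sqrt_sq hη.le]
    rw [h4] at h3
    have h5 : -(Real.pi : ℂ) / ((η ^ 2 : ℝ) : ℂ) * ((v : ℂ) + Complex.I * (Complex.I * u)) ^ 2 =
        ((-Real.pi * ((v - u) / η) ^ 2 : ℝ) : ℂ) := by
      rw [← mul_assoc, Complex.I_mul_I]
      push_cast
      field_simp
      ring
    rw [h5] at h3
    rw [VectorFourier.fourierIntegral]
    push_cast at h3 ⊢
    rw [← h3]
    refine integral_congr_ae (Eventually.of_forall fun w => ?_)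
    simp [mul_comm]
  simp only [e1, e2, smul_eq_mul] at h
  exact h.symm

/-- The mass of the Gaussian of width `η`. -/
lemma integral_gaussian_mass (u : ℝ) {η : ℝ} (hη : 0 < η) :
    ∫ v : ℝ, 1 / η * Real.exp (-Real.pi * ((v - u) / η) ^ 2) = 1 := by
  rw [integral_const_mul, integral_sub_right_eq_self
    (fun v : ℝ => Real.exp (-Real.pi * (v / η) ^ 2)) u,
    Measure.integral_comp_div (fun v : ℝ => Real.exp (-Real.pi * v ^ 2)) η, integral_gaussian,
    div_self Real.pi_ne_zero, abs_of_pos hη]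
  simp [hη.ne']

lemma integrable_gaussian_mass (u : ℝ) {η : ℝ} (hη : 0 < η) :
    Integrable fun v : ℝ => 1 / η * Real.exp (-Real.pi * ((v - u) / η) ^ 2) := by
  refine Integrable.const_mul ?_ _
  exact ((integrable_exp_neg_mul_sq Real.pi_pos).comp_div hη.ne').comp_sub_right u

lemma integrable_abs_mul_gaussian (u : ℝ) {η : ℝ} (hη : 0 < η) :
    Integrable fun v : ℝ => |v - u| * (1 / η * Real.exp (-Real.pi * ((v - u) / η) ^ 2)) := by
  have h := integrable_abs_rpow_mul_exp_neg_mul_sq Real.pi_pos (q := 1) (by norm_num)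
  simp only [Real.rpow_one] at h
  have h2 := (h.comp_div hη.ne').comp_sub_right u
  refine h2.congr (Eventually.of_forall fun v => ?_)
  simp only [abs_div, abs_of_pos hη]
  ring

lemma integral_abs_mul_gaussian_le : ∃ A : ℝ, 0 ≤ A ∧ ∀ u η : ℝ, 0 < η →
    ∫ v : ℝ, |v - u| * (1 / η * Real.exp (-Real.pi * ((v - u) / η) ^ 2)) = A * η := by
  refine ⟨∫ v : ℝ, |v| * Real.exp (-Real.pi * v ^ 2), integral_nonneg fun v => by positivity,
    fun u η hη => ?_⟩
  have e : ∀ v : ℝ, |v - u| * (1 / η * Real.exp (-Real.pi * ((v - u) / η) ^ 2)) =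
      (fun w : ℝ => |w| * Real.exp (-Real.pi * w ^ 2)) ((v - u) / η) := by
    intro v
    simp only [abs_div, abs_of_pos hη]
    ring
  simp_rw [e]
  rw [integral_sub_right_eq_self
    (fun v : ℝ => (fun w : ℝ => |w| * Real.exp (-Real.pi * w ^ 2)) (v / η)) u,
    Measure.integral_comp_div (fun w : ℝ => |w| * Real.exp (-Real.pi * w ^ 2)) η, abs_of_pos hη,
    smul_eq_mul, mul_comm]

/-- Laplace-weighted Möbius sum. -/
noncomputable def mobWeighted (σ v : ℝ) : ℝ := mobSum (Real.exp v) * (v * Real.exp (-(σ * v)))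

lemma integrable_mobWeighted {σ : ℝ} (hσ : 0 < σ) : Integrable (mobWeighted σ) := by
  have := (integrable_mobSum_mul_cexp (s := σ) (by simpa using hσ)).re
  refine this.congr (Eventually.of_forall fun v => ?_)
  simp only [mobWeighted]
  rw [← Complex.ofReal_re (mobSum (Real.exp v) * (v * Real.exp (-(σ * v))))]
  push_cast
  rfl

lemma exists_abs_integral_mobWeighted_mul_gaussian_le : ∃ C : ℝ, 0 < C ∧ ∀ σ η u : ℝ,
    0 < σ → σ ≤ 1 → 0 < η →
    |∫ v, mobWeighted σ v * (1 / η * Real.exp (-Real.pi * ((v - u) / η) ^ 2))| ≤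
      C * η ^ (-(1 / 4) : ℝ) := by
  obtain ⟨C, hC, h⟩ := exists_norm_deriv_inv_riemannZeta₁_le
  refine ⟨C * (2 * Real.pi) ^ (-(3 / 4) : ℝ) *
    (Real.pi ^ (-(1 / 8) : ℝ) * Real.Gamma (1 / 8)), ?_, fun σ η u hσ hσ1 hη => ?_⟩
  · have := Real.Gamma_pos_of_pos (s := 1 / 8) (by norm_num)
    positivity
  have hb : 0 < Real.pi * η ^ 2 := by positivity
  have hf : Integrable fun v => (mobWeighted σ v : ℂ) := (integrable_mobWeighted hσ).ofReal
  have key := integral_mul_gaussian_eq hf u hη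
  have e0 : ∫ v, (mobWeighted σ v : ℂ) *
      ((1 / η * Real.exp (-Real.pi * ((v - u) / η) ^ 2) : ℝ) : ℂ) =
      ((∫ v, mobWeighted σ v * (1 / η * Real.exp (-Real.pi * ((v - u) / η) ^ 2)) : ℝ) : ℂ) := by
    rw [← integral_complex_ofReal]
    push_cast
    rfl
  have e1 : ∀ ξ : ℝ, (∫ v : ℝ, Complex.exp ((-2 * Real.pi * v * ξ : ℝ) * Complex.I) *
      (mobWeighted σ v : ℂ)) =
      -deriv (fun w => (riemannZeta₁ w)⁻¹) (1 + σ + Complex.I * (2 * Real.pi * ξ : ℝ)) := by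
    intro ξ
    have := integral_mobSum_mul_cexp (s := σ + Complex.I * (2 * Real.pi * ξ : ℝ))
      (by simpa using hσ)
    rw [add_assoc, ← this]
    refine integral_congr_ae (Eventually.of_forall fun v => ?_)
    simp only [mobWeighted]
    push_cast
    rw [mul_comm (Complex.exp _), mul_assoc, mul_assoc, ← Complex.exp_add]
    ring_nf
  rw [e0] at key
  simp only [e1] at key
  rw [← Real.norm_eq_abs, ← Complex.norm_real, key]
  have hint := (integrable_abs_rpow_mul_exp_neg_mul_sq hb (q := -(3 / 4)) (by norm_num)).const_mul
    (C * (2 * Real.pi) ^ (-(3 / 4) : ℝ))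
  refine (norm_integral_le_of_norm_le hint ?_).trans ?_
  · have : ∀ᵐ ξ : ℝ, ξ ≠ 0 := by simp [ae_iff]
    filter_upwards [this] with ξ hξ
    have h2 : 2 * Real.pi * ξ ≠ 0 := by positivity
    have h3 := h σ (2 * Real.pi * ξ) hσ hσ1 h2
    rw [norm_mul, norm_neg, Complex.norm_exp]
    have e3 : (-(Real.pi : ℂ) * ((η ^ 2 : ℝ) : ℂ) * (ξ : ℂ) ^ 2 +
        2 * Real.pi * (Complex.I * u) * ξ).re = -(Real.pi * η ^ 2) * ξ ^ 2 := by
      have : (-(Real.pi : ℂ) * ((η ^ 2 : ℝ) : ℂ) * (ξ : ℂ) ^ 2 +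
        2 * Real.pi * (Complex.I * u) * ξ) = ((-(Real.pi * η ^ 2) * ξ ^ 2 : ℝ) : ℂ) +
          ((2 * Real.pi * u * ξ : ℝ) : ℂ) * Complex.I := by push_cast; ring
      rw [this, Complex.add_re, Complex.ofReal_re, Complex.re_ofReal_mul, Complex.I_re, mul_zero,
        add_zero]
    rw [e3]
    calc _ ≤ C * |2 * Real.pi * ξ| ^ (-(3 / 4) : ℝ) * Real.exp (-(Real.pi * η ^ 2) * ξ ^ 2) := by
          gcongr
      _ = _ := by
          rw [abs_mul, abs_of_pos (by positivity : 0 < 2 * Real.pi),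
            Real.mul_rpow (by positivity) (abs_nonneg _)]
          ring
  · rw [integral_const_mul, integral_abs_rpow_mul_exp_neg_mul_sq hb (by norm_num),
      Real.mul_rpow Real.pi_pos.le (by positivity), ← Real.rpow_natCast_mul hη.le]
    apply le_of_eq
    norm_num
    ring

lemma sum_Ioc_one_div_le_log {M N : ℕ} (hM : 1 ≤ M) (h : M ≤ N) :
    ∑ n ∈ Ioc M N, (1 : ℝ) / n ≤ Real.log N - Real.log M := by
  induction N, h using Nat.le_induction with
  | base => simp
  | succ N hN ih =>
    rw [sum_Ioc_succ_top (by omega)]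
    have hN0 : (0 : ℝ) < N := by exact_mod_cast (by omega : 0 < N)
    have h1 := Real.one_sub_inv_le_log_of_pos (x := ((N : ℝ) + 1) / N) (by positivity)
    rw [Real.log_div (by positivity) (by positivity)] at h1
    have h2 : 1 - (((N : ℝ) + 1) / N)⁻¹ = 1 / ((N : ℝ) + 1) := by field_simp; ring
    push_cast
    linarith

lemma sum_Ioc_floor_one_div_le {a b : ℝ} (ha : 0 < a) (hab : a ≤ b) :
    ∑ n ∈ Ioc ⌊a⌋₊ ⌊b⌋₊, (1 : ℝ) / n ≤ Real.log b - Real.log a + 1 / a := by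
  have hl := Real.log_le_log ha hab
  rcases (Nat.floor_le_floor hab).eq_or_lt with h | h
  · rw [h]; simp; have := inv_pos.2 ha; linarith
  · rw [← sum_Ioc_consecutive _ (Nat.le_succ ⌊a⌋₊) h]
    have h1 := sum_Ioc_one_div_le_log (M := ⌊a⌋₊ + 1) (by omega) h
    have h2 := Nat.lt_floor_add_one a
    have h3 : (⌊b⌋₊ : ℝ) ≤ b := Nat.floor_le (ha.le.trans hab)
    have h4 : Real.log ⌊b⌋₊ ≤ Real.log b := 
      Real.log_le_log (by exact_mod_cast (by omega : 0 < ⌊b⌋₊)) h3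
    have h5 : Real.log a ≤ Real.log ((⌊a⌋₊ + 1 : ℕ) : ℝ) := by
      push_cast; exact Real.log_le_log ha h2.le
    have h6 : ∑ n ∈ Ioc ⌊a⌋₊ (⌊a⌋₊ + 1), (1 : ℝ) / n ≤ 1 / a := by
      rw [sum_Ioc_succ_top le_rfl]
      simp only [Ioc_self, sum_empty, zero_add]
      push_cast
      gcongr
    simp only [Nat.succ_eq_add_one] at *
    linarith

lemma abs_mobSum_sub_le {a b : ℝ} (ha : 0 < a) (hab : a ≤ b) :
    |mobSum b - mobSum a| ≤ Real.log b - Real.log a + 1 / a := by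
  unfold mobSum
  rw [← sum_Ioc_consecutive _ (Nat.zero_le _) (Nat.floor_le_floor hab), add_sub_cancel_left]
  refine (abs_sum_le_sum_abs _ _).trans ((sum_le_sum fun n _ => ?_).trans
    (sum_Ioc_floor_one_div_le ha hab))
  rw [abs_div, Nat.abs_cast]
  gcongr
  exact abs_moebius_le_one_real n

lemma abs_mul_exp_neg_sub_le {σ u v : ℝ} (hσ : 0 ≤ σ) (hu : 0 ≤ u) (hv : 0 ≤ v) :
    |v * Real.exp (-(σ * v)) - u * Real.exp (-(σ * u))| ≤ |v - u| := by
  have hd : ∀ x ∈ Set.Ici (0 : ℝ), HasDerivWithinAt (fun v : ℝ => v * Real.exp (-(σ * v)))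
      ((1 - σ * x) * Real.exp (-(σ * x))) (Set.Ici 0) x := by
    intro x _
    have h1 : HasDerivAt (fun v : ℝ => Real.exp (-(σ * v))) (Real.exp (-(σ * x)) * -(σ * 1)) x :=
      ((hasDerivAt_id x).const_mul σ).fun_neg.exp
    refine (((hasDerivAt_id x).fun_mul h1).congr_deriv ?_).hasDerivWithinAt
    simp only [id]; ring
  have := (convex_Ici (0 : ℝ)).norm_image_sub_le_of_norm_hasDerivWithin_le (C := 1) hd
    (fun x hx => ?_) hu hv
  · simpa using this
  · have hx0 : 0 ≤ σ * x := mul_nonneg hσ hx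
    rw [Real.norm_eq_abs, abs_mul, Real.abs_exp, Real.exp_neg, ← div_eq_mul_inv,
      div_le_one (Real.exp_pos _)]
    have := Real.add_one_le_exp (σ * x)
    rw [abs_le]; constructor <;> linarith

lemma abs_mobWeighted_le {σ v : ℝ} (hσ : 0 ≤ σ) (hv : 0 ≤ v) : |mobWeighted σ v| ≤ v := by
  rw [mobWeighted, abs_mul, abs_mul, Real.abs_exp, abs_of_nonneg hv]
  have h1 : Real.exp (-(σ * v)) ≤ 1 := Real.exp_le_one_iff.2 (by have := mul_nonneg hσ hv; linarith)
  have h2 := abs_mobSum_le_one (Real.exp v)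
  calc _ ≤ 1 * (v * 1) := by gcongr
    _ = v := by ring

lemma abs_mobWeighted_sub_le {σ u v : ℝ} (hσ : 0 ≤ σ) (hu : 0 ≤ u) :
    |mobWeighted σ v - mobWeighted σ u| ≤ (3 + u) * |v - u| + u * Real.exp (-(u / 2)) := by
  have hFu := abs_mobWeighted_le hσ hu
  have hpos : 0 ≤ u * Real.exp (-(u / 2)) := by positivity
  have hpos2 : 0 ≤ u * |v - u| := by positivity
  rcases lt_or_ge v (u / 2) with hv | hv
  · have h1 : u / 2 ≤ |v - u| := by rw [abs_sub_comm]; exact le_trans (by linarith) (le_abs_self _)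
    have h2 : |mobWeighted σ v| ≤ u / 2 := by
      rcases lt_or_ge v 0 with h0 | h0
      · rw [mobWeighted, mobSum_eq_zero (by simpa using h0)]; simp; positivity
      · exact (abs_mobWeighted_le hσ h0).trans hv.le
    have := abs_sub (mobWeighted σ v) (mobWeighted σ u)
    linarith
  · have hv0 : 0 ≤ v := by linarith
    have h1 := abs_mul_exp_neg_sub_le hσ hu hv0
    have h2 : |mobSum (Real.exp v) - mobSum (Real.exp u)| ≤ |v - u| + Real.exp (-(u / 2)) := by
      rcases le_total v u with h | h
      · rw [abs_sub_comm, abs_sub_comm v]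
        refine (abs_mobSum_sub_le (Real.exp_pos v) (Real.exp_le_exp.2 h)).trans ?_
        rw [Real.log_exp, Real.log_exp, one_div, ← Real.exp_neg]
        gcongr
        exact le_abs_self _
      · refine (abs_mobSum_sub_le (Real.exp_pos u) (Real.exp_le_exp.2 h)).trans ?_
        rw [Real.log_exp, Real.log_exp, one_div, ← Real.exp_neg]
        gcongr
        · exact le_abs_self _
        · linarith
    have h3 : |u * Real.exp (-(σ * u))| ≤ u := by
      rw [abs_of_nonneg (by positivity)]
      exact mul_le_of_le_one_right hu
        (Real.exp_le_one_iff.2 (by have := mul_nonneg hσ hu; linarith))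
    have e : mobWeighted σ v - mobWeighted σ u =
        mobSum (Real.exp v) * (v * Real.exp (-(σ * v)) - u * Real.exp (-(σ * u))) +
        (mobSum (Real.exp v) - mobSum (Real.exp u)) * (u * Real.exp (-(σ * u))) := by
      unfold mobWeighted; ring
    rw [e]
    calc _ ≤ 1 * |v - u| + (|v - u| + Real.exp (-(u / 2))) * u := by
          refine (abs_add_le _ _).trans ?_
          rw [abs_mul, abs_mul]
          gcongr
          exact abs_mobSum_le_one _
      _ ≤ _ := by nlinarith [abs_nonneg (v - u)]

lemma exists_abs_mobSum_exp_le : ∃ C : ℝ, 0 < C ∧ ∀ u : ℝ, 1 ≤ u →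
    |mobSum (Real.exp u)| ≤ C * u ^ (-(3 / 4) : ℝ) := by
  obtain ⟨C, hC, h⟩ := exists_abs_integral_mobWeighted_mul_gaussian_le
  obtain ⟨A, hA, hA'⟩ := integral_abs_mul_gaussian_le
  refine ⟨Real.exp 1 * (C + (4 * A + 2)), by positivity, fun u hu => ?_⟩
  have hu0 : 0 < u := by linarith
  have hη : 0 < 1 / u := by positivity
  set G : ℝ → ℝ := fun v => 1 / (1 / u) * Real.exp (-Real.pi * ((v - u) / (1 / u)) ^ 2) with hG
  have hG0 : ∀ v, 0 ≤ G v := fun v => by rw [hG]; positivity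
  have hGi : Integrable G := integrable_gaussian_mass u hη
  have hGm : ∫ v, G v = 1 := integral_gaussian_mass u hη
  have hGa : Integrable fun v => |v - u| * G v := integrable_abs_mul_gaussian u hη
  have hGam : ∫ v, |v - u| * G v = A * (1 / u) := hA' u _ hη
  have hσ : 0 < 1 / u := hη
  have hσ1 : 1 / u ≤ 1 := by rw [div_le_one hu0]; exact hu
  have hmain := h (1 / u) (1 / u) u hσ hσ1 hη
  change |∫ v, mobWeighted (1 / u) v * G v| ≤ _ at hmain
  have hdom : Integrable fun v => (3 + u) * (|v - u| * G v) + u * Real.exp (-(u / 2)) * G v :=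
    (hGa.const_mul _).add (hGi.const_mul _)
  have hptw : ∀ v, ‖(mobWeighted (1 / u) v - mobWeighted (1 / u) u) * G v‖ ≤
      (3 + u) * (|v - u| * G v) + u * Real.exp (-(u / 2)) * G v := by
    intro v
    rw [norm_mul, Real.norm_eq_abs, Real.norm_of_nonneg (hG0 v)]
    calc _ ≤ ((3 + u) * |v - u| + u * Real.exp (-(u / 2))) * G v := by
          gcongr
          exact abs_mobWeighted_sub_le hσ.le hu0.le
      _ = _ := by ring
  have hFm : AEStronglyMeasurable (mobWeighted (1 / u)) volume := (integrable_mobWeighted hσ).1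
  have hDi : Integrable fun v => (mobWeighted (1 / u) v - mobWeighted (1 / u) u) * G v :=
    hdom.mono' ((hFm.sub aestronglyMeasurable_const).mul hGi.1) (Eventually.of_forall hptw)
  have hD := norm_integral_le_of_norm_le hdom (Eventually.of_forall hptw)
  rw [integral_add (hGa.const_mul _) (hGi.const_mul _), integral_const_mul, integral_const_mul, hGm,
    hGam] at hD
  have hsplit : ∫ v, mobWeighted (1 / u) v * G v =
      (∫ v, (mobWeighted (1 / u) v - mobWeighted (1 / u) u) * G v) + mobWeighted (1 / u) u := by
    have : ∀ v, mobWeighted (1 / u) v * G v =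
        (mobWeighted (1 / u) v - mobWeighted (1 / u) u) * G v + mobWeighted (1 / u) u * G v := by
      intro v; ring
    simp_rw [this]
    rw [integral_add hDi (hGi.const_mul _), integral_const_mul, hGm, mul_one]
  rw [hsplit] at hmain
  rw [Real.norm_eq_abs] at hD
  have hb1 : (3 + u) * (A * (1 / u)) ≤ 4 * A := by
    rw [← mul_assoc, mul_one_div, div_le_iff₀ hu0]; nlinarith
  have hb2 : u * Real.exp (-(u / 2)) * 1 ≤ 2 := by
    have := Real.add_one_le_exp (u / 2)
    rw [mul_one, Real.exp_neg, ← div_eq_mul_inv, div_le_iff₀ (Real.exp_pos _)]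
    linarith
  have hpow : (1 / u) ^ (-(1 / 4) : ℝ) = u ^ (1 / 4 : ℝ) := by
    rw [one_div, Real.inv_rpow hu0.le, Real.rpow_neg hu0.le, inv_inv]
  rw [hpow] at hmain
  have hone : 1 ≤ u ^ (1 / 4 : ℝ) := Real.one_le_rpow hu (by norm_num)
  have hF : |mobWeighted (1 / u) u| ≤ (C + (4 * A + 2)) * u ^ (1 / 4 : ℝ) := by
    have h1 : |mobWeighted (1 / u) u| ≤ C * u ^ (1 / 4 : ℝ) + (4 * A + 2) := by
      rw [abs_le] at hmain hD ⊢
      constructor <;> linarith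
    nlinarith
  have hval : |mobWeighted (1 / u) u| = |mobSum (Real.exp u)| * u / Real.exp 1 := by
    rw [mobWeighted, one_div_mul_cancel hu0.ne', Real.exp_neg, abs_mul, abs_of_pos (by positivity :
      0 < u * (Real.exp 1)⁻¹)]
    ring
  rw [hval, div_le_iff₀ (Real.exp_pos 1)] at hF
  have hfin : u ^ (-(3 / 4) : ℝ) = u ^ (1 / 4 : ℝ) / u := by
    rw [← Real.rpow_sub_one hu0.ne']; norm_num
  rw [hfin, mul_div_assoc', le_div_iff₀ hu0]
  linarith

lemma exists_abs_mobSum_le : ∃ C : ℝ, 0 < C ∧ ∀ y : ℝ, 1 ≤ y →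
    |mobSum y| ≤ C * (1 + Real.log y) ^ (-(3 / 4) : ℝ) := by
  obtain ⟨C, hC, h⟩ := exists_abs_mobSum_exp_le
  refine ⟨2 * (C + 1), by positivity, fun y hy => ?_⟩
  have hl := Real.log_nonneg hy
  have h2 : (1 / 2 : ℝ) ≤ 2 ^ (-(3 / 4) : ℝ) := by
    rw [one_div, ← Real.rpow_neg_one]
    exact Real.rpow_le_rpow_of_exponent_le (by norm_num) (by norm_num)
  rcases le_total 1 (Real.log y) with h1 | h1
  · have := h _ h1
    rw [Real.exp_log (by linarith)] at this
    refine this.trans ?_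
    have h3 : (2 * Real.log y) ^ (-(3 / 4) : ℝ) ≤ (1 + Real.log y) ^ (-(3 / 4) : ℝ) :=
      Real.rpow_le_rpow_of_nonpos (by positivity) (by linarith) (by norm_num)
    rw [Real.mul_rpow (by norm_num) hl] at h3
    have h4 : 0 ≤ Real.log y ^ (-(3 / 4) : ℝ) := by positivity
    have h5 : Real.log y ^ (-(3 / 4) : ℝ) ≤ 2 * (1 + Real.log y) ^ (-(3 / 4) : ℝ) := by nlinarith
    nlinarith
  · have h3 : (2 : ℝ) ^ (-(3 / 4) : ℝ) ≤ (1 + Real.log y) ^ (-(3 / 4) : ℝ) :=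
      Real.rpow_le_rpow_of_nonpos (by positivity) (by linarith) (by norm_num)
    have := abs_mobSum_le_one y
    nlinarith

/-- `n ↦ 1 / n` restricted to `n` all of whose prime factors divide `k`. -/
noncomputable def invSmooth (k : ℕ) : ArithmeticFunction ℝ where
  toFun n := if n.primeFactors ⊆ k.primeFactors then (1 / n : ℝ) else 0
  map_zero' := by simp

/-- `n ↦ μ(n) / n`. -/
noncomputable def mobDiv : ArithmeticFunction ℝ where
  toFun n := (ArithmeticFunction.moebius n : ℝ) / n
  map_zero' := by simp

/-- `n ↦ μ(n) / n` restricted to `n` coprime to `k`. -/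
noncomputable def mobDivCoprime (k : ℕ) : ArithmeticFunction ℝ where
  toFun n := if n.Coprime k then (ArithmeticFunction.moebius n : ℝ) / n else 0
  map_zero' := by simp

lemma invSmooth_apply (k n : ℕ) :
    invSmooth k n = if n.primeFactors ⊆ k.primeFactors then (1 / n : ℝ) else 0 := rfl

lemma mobDiv_apply (n : ℕ) : mobDiv n = (ArithmeticFunction.moebius n : ℝ) / n := rfl

lemma mobDivCoprime_apply (k n : ℕ) :
    mobDivCoprime k n = if n.Coprime k then (ArithmeticFunction.moebius n : ℝ) / n else 0 := rfl

lemma isMultiplicative_invSmooth (k : ℕ) : (invSmooth k).IsMultiplicative := by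
  rw [ArithmeticFunction.IsMultiplicative.iff_ne_zero]
  refine ⟨by simp [invSmooth_apply], fun {m n} hm hn _ => ?_⟩
  simp only [invSmooth_apply, Nat.primeFactors_mul hm hn, union_subset_iff]
  by_cases h1 : m.primeFactors ⊆ k.primeFactors <;> by_cases h2 : n.primeFactors ⊆ k.primeFactors <;>
    simp [h1, h2, mul_comm]

lemma isMultiplicative_mobDiv : mobDiv.IsMultiplicative := by
  rw [ArithmeticFunction.IsMultiplicative.iff_ne_zero]
  refine ⟨by simp [mobDiv_apply], fun {m n} hm hn h => ?_⟩
  simp only [mobDiv_apply, ArithmeticFunction.isMultiplicative_moebius.map_mul_of_coprime h]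
  push_cast
  rw [mul_div_mul_comm]

lemma isMultiplicative_mobDivCoprime (k : ℕ) : (mobDivCoprime k).IsMultiplicative := by
  rw [ArithmeticFunction.IsMultiplicative.iff_ne_zero]
  refine ⟨by simp [mobDivCoprime_apply], fun {m n} hm hn h => ?_⟩
  simp only [mobDivCoprime_apply, ArithmeticFunction.isMultiplicative_moebius.map_mul_of_coprime h,
    Nat.coprime_mul_iff_left]
  by_cases h1 : m.Coprime k <;> by_cases h2 : n.Coprime k
  · rw [if_pos ⟨h1, h2⟩, if_pos h1, if_pos h2]
    push_cast
    rw [mul_div_mul_comm]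
  · rw [if_neg fun h => h2 h.2, if_neg h2, mul_zero]
  · rw [if_neg fun h => h1 h.1, if_neg h1, zero_mul]
  · rw [if_neg fun h => h1 h.1, if_neg h1, zero_mul]

lemma invSmooth_mul_mobDiv {k : ℕ} (hk0 : k ≠ 0) : invSmooth k * mobDiv = mobDivCoprime k := by
  rw [((isMultiplicative_invSmooth k).mul isMultiplicative_mobDiv).eq_iff_eq_on_prime_powers _ _
    (isMultiplicative_mobDivCoprime k)]
  intro p i hp
  rw [ArithmeticFunction.mul_apply]
  have hp0 : (p : ℝ) ≠ 0 := by exact_mod_cast hp.ne_zero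
  rcases Nat.eq_zero_or_pos i with rfl | hi
  · simp [invSmooth_apply, mobDiv_apply, mobDivCoprime_apply]
  have hpi : p ^ i ≠ 0 := (pow_pos hp.pos i).ne'
  by_cases hk : p ∈ k.primeFactors
  · have e : ∀ x ∈ (p ^ i).divisorsAntidiagonal, invSmooth k x.1 * mobDiv x.2 =
        (1 / (p ^ i : ℕ) : ℝ) * (((ArithmeticFunction.zeta : ArithmeticFunction ℤ) x.1 *
          ArithmeticFunction.moebius x.2 : ℤ) : ℝ) := by
      rintro ⟨a, b⟩ hx
      rw [Nat.mem_divisorsAntidiagonal] at hx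
      have hab : a * b = p ^ i := hx.1
      have ha : a ≠ 0 := by rintro rfl; simp at hab; exact hpi hab.symm
      have hs : a.primeFactors ⊆ k.primeFactors := by
        refine (Nat.primeFactors_mono (Dvd.intro _ hab) hpi).trans ?_
        rw [Nat.primeFactors_prime_pow hi.ne' hp]
        simpa using hk
      simp only [invSmooth_apply, mobDiv_apply, hs, if_true, ← hab,
        ArithmeticFunction.natCoe_apply, ArithmeticFunction.zeta_apply, ha, if_false]
      push_cast
      rw [one_mul, div_mul_div_comm]; ring
    rw [sum_congr rfl e, ← mul_sum, ← Int.cast_sum, ← ArithmeticFunction.mul_apply,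
      ArithmeticFunction.coe_zeta_mul_moebius, ArithmeticFunction.one_apply_ne
        (one_lt_pow₀ hp.one_lt hi.ne').ne', mobDivCoprime_apply, if_neg]
    · simp
    · rw [Nat.coprime_pow_left_iff hi, hp.coprime_iff_not_dvd, not_not]
      exact (Nat.mem_primeFactors.1 hk).2.1
  · rw [sum_eq_single (1, p ^ i)]
    · have hc : (p ^ i).Coprime k := by
        rw [Nat.coprime_pow_left_iff hi, hp.coprime_iff_not_dvd]
        intro hpk
        exact hk (Nat.mem_primeFactors.2 ⟨hp, hpk, hk0⟩)
      rw [mobDivCoprime_apply, if_pos hc]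
      simp [invSmooth_apply, mobDiv_apply]
    · rintro ⟨a, b⟩ hx hne
      rw [Nat.mem_divisorsAntidiagonal] at hx
      have hab : a * b = p ^ i := hx.1
      obtain ⟨j, -, hj⟩ := (Nat.dvd_prime_pow hp).1 (Dvd.intro _ hab)
      rcases Nat.eq_zero_or_pos j with rfl | hj0
      · simp only [pow_zero] at hj
        subst hj
        rw [one_mul] at hab
        exact absurd (by rw [hab]) hne
      · have : ¬ a.primeFactors ⊆ k.primeFactors := by
          rw [hj, Nat.primeFactors_prime_pow hj0.ne' hp]
          simpa using hk
        simp only [invSmooth_apply, this, if_false, zero_mul]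
    · intro h
      exact absurd (Nat.mem_divisorsAntidiagonal.2 ⟨one_mul _, hpi⟩) h

lemma abs_sum_mobDivCoprime_le {k : ℕ} (hk : k ≠ 0) (y : ℝ) :
    |∑ n ∈ Ioc 0 ⌊y⌋₊, mobDivCoprime k n| ≤
      ∑ l ∈ Ioc 0 ⌊y⌋₊, invSmooth k l * |mobSum (y / l)| := by
  rw [← invSmooth_mul_mobDiv hk, ArithmeticFunction.sum_Ioc_mul_eq_sum_sum]
  refine (abs_sum_le_sum_abs _ _).trans (sum_le_sum fun l _ => ?_)
  rw [abs_mul, mobSum, Nat.floor_div_natCast]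
  have : 0 ≤ invSmooth k l := by
    rw [invSmooth_apply]; split_ifs <;> positivity
  rw [abs_of_nonneg this]
  rfl

/-- The constant-free weight of `l` in the coprime Möbius sums. -/
noncomputable def logWeight (l : ℕ) : ℝ := (1 + Real.log l) / l

lemma logWeight_nonneg (l : ℕ) : 0 ≤ logWeight l := by
  have := Real.log_natCast_nonneg l
  unfold logWeight; positivity

lemma exists_abs_sum_mobDivCoprime_le : ∃ C : ℝ, 0 < C ∧ ∀ k : ℕ, k ≠ 0 → ∀ y : ℝ, 1 ≤ y →
    |∑ n ∈ Ioc 0 ⌊y⌋₊, mobDivCoprime k n| ≤ C * (1 + Real.log y) ^ (-(3 / 4) : ℝ) *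
      ∑ l ∈ (Ioc 0 ⌊y⌋₊).filter (fun l => l.primeFactors ⊆ k.primeFactors), logWeight l := by
  obtain ⟨C, hC, h⟩ := exists_abs_mobSum_le
  refine ⟨C, hC, fun k hk y hy => (abs_sum_mobDivCoprime_le hk y).trans ?_⟩
  rw [sum_filter, mul_sum]
  refine sum_le_sum fun l hl => ?_
  rw [invSmooth_apply]
  split_ifs with hs
  swap
  · simp
  rw [mem_Ioc, Nat.le_floor_iff (by linarith)] at hl
  have hl0 : (0 : ℝ) < l := by exact_mod_cast hl.1
  have hyl : 1 ≤ y / l := by rw [le_div_iff₀ hl0]; linarith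
  have h1 := h _ hyl
  have hL := Real.log_natCast_nonneg l
  have hLy := Real.log_nonneg hyl
  have hA : 1 + Real.log y ≤ (1 + Real.log (y / l)) * (1 + Real.log l) := by
    rw [Real.log_div (by linarith) hl0.ne'] at hLy ⊢
    nlinarith
  have hly := Real.log_nonneg hy
  have h2 : (1 + Real.log (y / l)) ^ (-(3 / 4) : ℝ) ≤
      (1 + Real.log y) ^ (-(3 / 4) : ℝ) * (1 + Real.log l) := by
    have h3 : ((1 + Real.log (y / l)) * (1 + Real.log l)) ^ (-(3 / 4) : ℝ) ≤
        (1 + Real.log y) ^ (-(3 / 4) : ℝ) :=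
      Real.rpow_le_rpow_of_nonpos (by positivity) hA (by norm_num)
    rw [Real.mul_rpow (by positivity) (by positivity)] at h3
    have h4 : 1 ≤ (1 + Real.log l) ^ (-(3 / 4) : ℝ) * (1 + Real.log l) := by
      rw [← Real.rpow_add_one (by positivity)]
      exact Real.one_le_rpow (by linarith) (by norm_num)
    have h5 : 0 ≤ (1 + Real.log (y / l)) ^ (-(3 / 4) : ℝ) := by positivity
    calc _ ≤ (1 + Real.log (y / l)) ^ (-(3 / 4) : ℝ) *
          ((1 + Real.log l) ^ (-(3 / 4) : ℝ) * (1 + Real.log l)) := le_mul_of_one_le_right h5 h4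
      _ = (1 + Real.log (y / l)) ^ (-(3 / 4) : ℝ) * (1 + Real.log l) ^ (-(3 / 4) : ℝ) *
          (1 + Real.log l) := by ring
      _ ≤ _ := by gcongr
  calc _ ≤ 1 / (l : ℝ) * (C * ((1 + Real.log y) ^ (-(3 / 4) : ℝ) * (1 + Real.log l))) := by
        gcongr; exact h1.trans (by gcongr)
    _ = _ := by unfold logWeight; ring

/-- The summand bounding the diagonal contributions to `Q`. -/
noncomputable def logKernel (Y : ℝ) (j : ℕ) : ℝ :=
  1 / j * ((1 + Real.log (Y / j)) ^ (-(3 / 4) : ℝ)) ^ 2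

lemma logKernel_nonneg (Y : ℝ) (j : ℕ) : 0 ≤ logKernel Y j := by
  unfold logKernel; positivity

lemma logKernel_le_sub {Y : ℝ} {j : ℕ} (hj : 1 ≤ j) (hY : (j : ℝ) + 1 ≤ Y) :
    logKernel Y j ≤ 4 * ((Real.sqrt (1 + Real.log (Y / (j + 1 : ℕ))))⁻¹ -
      (Real.sqrt (1 + Real.log (Y / j)))⁻¹) := by
  have hj0 : (0 : ℝ) < j := by exact_mod_cast hj
  have hj1 : (1 : ℝ) ≤ j := by exact_mod_cast hj
  have hY0 : 0 < Y := by linarith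
  push_cast
  set A := 1 + Real.log (Y / j) with hA
  set B := 1 + Real.log (Y / (j + 1)) with hB
  have hB1 : 1 ≤ B := by
    have : 0 ≤ Real.log (Y / (j + 1)) := Real.log_nonneg (by rw [le_div_iff₀ (by positivity)]; linarith)
    linarith
  have hAB : 1 / (2 * j) ≤ A - B := by
    have h1 := Real.one_sub_inv_le_log_of_pos (x := ((j : ℝ) + 1) / j) (by positivity)
    rw [Real.log_div (by positivity) (by positivity)] at h1
    rw [hA, hB, Real.log_div hY0.ne' hj0.ne', Real.log_div hY0.ne' (by positivity)]
    have h2 : 1 / (2 * (j : ℝ)) ≤ 1 - (((j : ℝ) + 1) / j)⁻¹ := by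
      have : 1 - (((j : ℝ) + 1) / j)⁻¹ = 1 / ((j : ℝ) + 1) := by field_simp; ring
      rw [this]
      gcongr; linarith
    linarith
  have hA1 : B ≤ A := by have : 0 < 1 / (2 * (j : ℝ)) := by positivity
                         linarith
  have hA0 : 0 < A := by linarith
  have hB0 : 0 < B := by linarith
  have hpow : (A ^ (-(3 / 4) : ℝ)) ^ 2 = (Real.sqrt A ^ 3)⁻¹ := by
    rw [← Real.rpow_mul_natCast hA0.le, Real.sqrt_eq_rpow, ← Real.rpow_mul_natCast hA0.le,
      ← Real.rpow_neg hA0.le]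
    norm_num
  rw [logKernel, ← hA, hpow]
  set a := Real.sqrt A
  set b := Real.sqrt B
  have hb1 : 1 ≤ b := Real.one_le_sqrt.2 hB1
  have hba : b ≤ a := Real.sqrt_le_sqrt hA1
  have ea : a ^ 2 = A := Real.sq_sqrt hA0.le
  have eb : b ^ 2 = B := Real.sq_sqrt hB0.le
  rw [← ea, ← eb] at hAB
  have ha0 : 0 < a := by linarith
  have hb0 : 0 < b := by linarith
  have h3 : 1 / (j : ℝ) ≤ 2 * (a ^ 2 - b ^ 2) := by
    have : 1 / (j : ℝ) = 2 * (1 / (2 * j)) := by field_simp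
    rw [this]; linarith
  calc _ ≤ 2 * (a ^ 2 - b ^ 2) * (a ^ 3)⁻¹ := by gcongr
    _ ≤ 4 * (b⁻¹ - a⁻¹) := by
      rw [← div_eq_mul_inv, div_le_iff₀ (by positivity)]
      have : 4 * (b⁻¹ - a⁻¹) * a ^ 3 = 4 * (a - b) * (a ^ 2 / b) := by field_simp
      rw [this]
      have h4 : a ≤ a ^ 2 / b := by rw [le_div_iff₀ hb0]; nlinarith
      nlinarith

lemma sum_logKernel_le (Y : ℝ) : ∑ j ∈ Ioc 0 ⌊Y⌋₊, logKernel Y j ≤ 5 := by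
  rcases Nat.eq_zero_or_pos ⌊Y⌋₊ with h | h
  · simp [h]
  have hY : 0 < Y := Nat.pos_of_floor_pos h
  have hfl : (⌊Y⌋₊ : ℝ) ≤ Y := Nat.floor_le hY.le
  obtain ⟨N, hN⟩ : ∃ N, ⌊Y⌋₊ = N + 1 := ⟨⌊Y⌋₊ - 1, by omega⟩
  rw [hN] at hfl ⊢
  push_cast at hfl
  rw [sum_Ioc_succ_top (by omega)]
  have hind : ∀ M : ℕ, M ≤ N → ∑ j ∈ Ioc 0 M, logKernel Y j ≤
      4 * (Real.sqrt (1 + Real.log (Y / (M + 1 : ℕ))))⁻¹ := by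
    intro M
    induction M with
    | zero => intro _; simp
    | succ M ih =>
      intro hM
      rw [sum_Ioc_succ_top (by omega)]
      have h1 := logKernel_le_sub (Y := Y) (j := M + 1) (by omega) (by
        have : ((M + 1 : ℕ) : ℝ) ≤ N := by exact_mod_cast hM
        linarith)
      have := ih (by omega)
      linarith
  have h1 := hind N le_rfl
  have hlog : 0 ≤ Real.log (Y / (N + 1 : ℕ)) := Real.log_nonneg (by
    push_cast; rw [le_div_iff₀ (by positivity)]; linarith)
  have h2 : (Real.sqrt (1 + Real.log (Y / (N + 1 : ℕ))))⁻¹ ≤ 1 :=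
    inv_le_one_of_one_le₀ (Real.one_le_sqrt.2 (by linarith))
  have h3 : logKernel Y (N + 1) ≤ 1 := by
    unfold logKernel
    have h4 : (1 + Real.log (Y / (N + 1 : ℕ))) ^ (-(3 / 4) : ℝ) ≤ 1 :=
      Real.rpow_le_one_of_one_le_of_nonpos (by linarith) (by norm_num)
    have h5 : 1 / ((N + 1 : ℕ) : ℝ) ≤ 1 := by
      rw [div_le_one (by positivity)]; push_cast; linarith [Nat.cast_nonneg (α := ℝ) N]
    have h6 : 0 ≤ (1 + Real.log (Y / (N + 1 : ℕ))) ^ (-(3 / 4) : ℝ) := by positivity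
    exact mul_le_one₀ h5 (by positivity) (pow_le_one₀ h6 h4)
  linarith

lemma sum_logKernel_dvd_le {R : ℕ} (hR : 0 < R) (t : ℝ) :
    ∑ k ∈ (Ioc 0 ⌊t⌋₊).filter (fun k => R ∣ k), logKernel t k ≤ 5 / R := by
  have e : (Ioc 0 ⌊t⌋₊).filter (fun k => R ∣ k) = (Ioc 0 ⌊t / R⌋₊).image (fun j => R * j) := by
    ext k
    simp only [mem_filter, mem_Ioc, mem_image, Nat.floor_div_natCast]
    constructor
    · rintro ⟨⟨h1, h2⟩, j, rfl⟩
      exact ⟨j, ⟨Nat.pos_of_mul_pos_left h1, (Nat.le_div_iff_mul_le hR).2 (by rwa [mul_comm])⟩, rfl⟩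
    · rintro ⟨j, ⟨h1, h2⟩, rfl⟩
      exact ⟨⟨by positivity, by rw [mul_comm]; exact (Nat.le_div_iff_mul_le hR).1 h2⟩, Dvd.intro _ rfl⟩
  rw [e, sum_image (fun a _ b _ h => Nat.eq_of_mul_eq_mul_left hR h)]
  have hR0 : (0 : ℝ) < R := by exact_mod_cast hR
  have e2 : ∀ j : ℕ, logKernel t (R * j) = 1 / R * logKernel (t / R) j := by
    intro j
    unfold logKernel
    push_cast
    rw [div_div]
    field_simp
  simp_rw [e2]
  rw [← mul_sum, div_eq_mul_one_div 5, mul_comm 5]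
  have := sum_logKernel_le (t / R)
  gcongr

/-- The quadratic form `∑ μ(m) μ(n) / [m, n]` over `m, n ≤ N`. -/
noncomputable def mobQuad (N : ℕ) : ℝ :=
  ∑ m ∈ Ioc 0 N, ∑ n ∈ Ioc 0 N,
    (ArithmeticFunction.moebius m : ℝ) * ArithmeticFunction.moebius n / (Nat.lcm m n : ℝ)

lemma gcd_eq_sum_totient {m n N : ℕ} (hm : 0 < m) (hmN : m ≤ N) :
    ((Nat.gcd m n : ℕ) : ℝ) =
      ∑ k ∈ Ioc 0 N, if k ∣ m ∧ k ∣ n then (Nat.totient k : ℝ) else 0 := by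
  rw [← Nat.sum_totient (Nat.gcd m n), ← sum_filter]
  push_cast
  refine sum_congr ?_ fun _ _ => rfl
  ext k
  simp only [Nat.mem_divisors, mem_filter, mem_Ioc, Nat.dvd_gcd_iff]
  constructor
  · rintro ⟨h, -⟩
    exact ⟨⟨Nat.pos_of_dvd_of_pos h.1 hm, (Nat.le_of_dvd hm h.1).trans hmN⟩, h⟩
  · rintro ⟨-, h⟩
    exact ⟨h, (Nat.gcd_pos_of_pos_left n hm).ne'⟩

lemma mobQuad_eq (N : ℕ) : mobQuad N = ∑ k ∈ Ioc 0 N, (Nat.totient k : ℝ) *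
    (∑ d ∈ (Ioc 0 N).filter (fun d => k ∣ d), (ArithmeticFunction.moebius d : ℝ) / d) ^ 2 := by
  have e : ∀ m ∈ Ioc 0 N, ∀ n ∈ Ioc 0 N,
      (ArithmeticFunction.moebius m : ℝ) * ArithmeticFunction.moebius n / (Nat.lcm m n : ℝ) =
      ∑ k ∈ Ioc 0 N, (Nat.totient k : ℝ) *
        ((if k ∣ m then (ArithmeticFunction.moebius m : ℝ) / m else 0) *
        (if k ∣ n then (ArithmeticFunction.moebius n : ℝ) / n else 0)) := by
    intro m hm n hn
    rw [mem_Ioc] at hm hn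
    have hm0 : (m : ℝ) ≠ 0 := by exact_mod_cast hm.1.ne'
    have hn0 : (n : ℝ) ≠ 0 := by exact_mod_cast hn.1.ne'
    have hl0 : ((Nat.lcm m n : ℕ) : ℝ) ≠ 0 := by
      exact_mod_cast (Nat.lcm_pos hm.1 hn.1).ne'
    have hg := gcd_eq_sum_totient (n := n) hm.1 hm.2
    have hgl : ((Nat.gcd m n : ℕ) : ℝ) * (Nat.lcm m n : ℕ) = m * n := by
      exact_mod_cast Nat.gcd_mul_lcm m n
    have h1 : (ArithmeticFunction.moebius m : ℝ) * ArithmeticFunction.moebius n /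
        (Nat.lcm m n : ℝ) = ((Nat.gcd m n : ℕ) : ℝ) *
        ((ArithmeticFunction.moebius m : ℝ) / m * ((ArithmeticFunction.moebius n : ℝ) / n)) := by
      rw [div_mul_div_comm, ← hgl]
      have hg0 : ((Nat.gcd m n : ℕ) : ℝ) ≠ 0 := by
        exact_mod_cast (Nat.gcd_pos_of_pos_left n hm.1).ne'
      field_simp
    rw [h1, hg, sum_mul]
    refine sum_congr rfl fun k _ => ?_
    by_cases h2 : k ∣ m <;> by_cases h3 : k ∣ n <;> simp [h2, h3]
  unfold mobQuad
  rw [sum_congr rfl fun m hm => sum_congr rfl (e m hm)]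
  rw [sum_congr rfl fun m _ => sum_comm, sum_comm]
  refine sum_congr rfl fun k _ => ?_
  simp_rw [← mul_sum]
  congr 1
  rw [sq, sum_filter, sum_mul_sum]
  simp_rw [mul_sum]

lemma sum_filter_dvd_moebius_div {N k : ℕ} (hk : 0 < k) :
    ∑ d ∈ (Ioc 0 N).filter (fun d => k ∣ d), (ArithmeticFunction.moebius d : ℝ) / d =
      (ArithmeticFunction.moebius k : ℝ) / k * ∑ n ∈ Ioc 0 (N / k), mobDivCoprime k n := by
  have e : (Ioc 0 N).filter (fun d => k ∣ d) = (Ioc 0 (N / k)).image (fun j => k * j) := by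
    ext d
    simp only [mem_filter, mem_Ioc, mem_image]
    constructor
    · rintro ⟨⟨h1, h2⟩, j, rfl⟩
      exact ⟨j, ⟨Nat.pos_of_mul_pos_left h1, (Nat.le_div_iff_mul_le hk).2 (by rwa [mul_comm])⟩, rfl⟩
    · rintro ⟨j, ⟨h1, h2⟩, rfl⟩
      exact ⟨⟨by positivity, by rw [mul_comm]; exact (Nat.le_div_iff_mul_le hk).1 h2⟩, Dvd.intro _ rfl⟩
  rw [e, sum_image (fun a _ b _ h => Nat.eq_of_mul_eq_mul_left hk h), mul_sum]
  refine sum_congr rfl fun j hj => ?_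
  rw [mobDivCoprime_apply]
  by_cases h : j.Coprime k
  · rw [if_pos h, ArithmeticFunction.isMultiplicative_moebius.map_mul_of_coprime h.symm]
    push_cast
    rw [mul_div_mul_comm]
  · rw [if_neg h, ArithmeticFunction.moebius_eq_zero_of_not_squarefree]
    · simp
    · intro hs
      exact h (Nat.coprime_of_squarefree_mul hs).symm

lemma mobQuad_le (N : ℕ) :
    mobQuad N ≤ ∑ k ∈ Ioc 0 N, 1 / (k : ℝ) * (∑ n ∈ Ioc 0 (N / k), mobDivCoprime k n) ^ 2 := by
  rw [mobQuad_eq]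
  refine sum_le_sum fun k hk => ?_
  have hk0 : 0 < k := (mem_Ioc.1 hk).1
  have hk1 : (0 : ℝ) < k := by exact_mod_cast hk0
  rw [sum_filter_dvd_moebius_div hk0, mul_pow, ← mul_assoc]
  gcongr
  have h1 : (Nat.totient k : ℝ) ≤ k := by exact_mod_cast Nat.totient_le k
  have h2 : (ArithmeticFunction.moebius k : ℝ) ^ 2 ≤ 1 := by
    rw [sq_le_one_iff_abs_le_one]; exact abs_moebius_le_one_real k
  rw [div_pow]
  calc _ ≤ (k : ℝ) * (1 / (k : ℝ) ^ 2) := by gcongr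
    _ = 1 / k := by field_simp

/-- A squarefree number whose quotient from `n` is a square. -/
noncomputable def sqfreePart (n : ℕ) : ℕ := (Nat.sq_mul_squarefree n).choose

/-- The square root of the quotient of `n` by `sqfreePart n`. -/
noncomputable def sqrtPart (n : ℕ) : ℕ := (Nat.sq_mul_squarefree n).choose_spec.choose

lemma sqrtPart_sq_mul_sqfreePart (n : ℕ) : sqrtPart n ^ 2 * sqfreePart n = n :=
  (Nat.sq_mul_squarefree n).choose_spec.choose_spec.1

lemma squarefree_sqfreePart (n : ℕ) : Squarefree (sqfreePart n) :=
  (Nat.sq_mul_squarefree n).choose_spec.choose_spec.2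

lemma sqfreePart_pos (n : ℕ) : 0 < sqfreePart n :=
  Nat.pos_of_ne_zero (squarefree_sqfreePart n).ne_zero

lemma sqrtPart_pos {n : ℕ} (hn : 0 < n) : 0 < sqrtPart n := by
  rw [← sqrtPart_sq_mul_sqfreePart n] at hn
  by_contra h
  simp [Nat.eq_zero_of_not_pos h] at hn

lemma sqfreePart_dvd_of_primeFactors_subset {l k : ℕ} (hl : l ≠ 0)
    (h : l.primeFactors ⊆ k.primeFactors) : sqfreePart l ∣ k := by
  have h1 : sqfreePart l ∣ l := Dvd.intro_left _ (sqrtPart_sq_mul_sqfreePart l)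
  rw [← Nat.prod_primeFactors_of_squarefree (squarefree_sqfreePart l)]
  exact (prod_dvd_prod_of_subset _ _ _ ((Nat.primeFactors_mono h1 hl).trans h)).trans
    (Nat.prod_primeFactors_dvd k)

lemma logWeight_div_sqrt_le {l : ℕ} (hl : 0 < l) :
    logWeight l / Real.sqrt (sqfreePart l) ≤
      8 * ((sqfreePart l : ℝ) ^ (-(11 / 8) : ℝ) * (sqrtPart l : ℝ) ^ (-(7 / 4) : ℝ)) := by
  have hl0 : (0 : ℝ) < l := by exact_mod_cast hl
  have ha : (0 : ℝ) < sqfreePart l := by exact_mod_cast sqfreePart_pos l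
  have hb : (0 : ℝ) < sqrtPart l := by exact_mod_cast sqrtPart_pos hl
  have h1 : 1 + Real.log l ≤ 8 * (l : ℝ) ^ (1 / 8 : ℝ) := by
    have := Real.log_le_sub_one_of_pos (x := (l : ℝ) ^ (1 / 8 : ℝ)) (by positivity)
    rw [Real.log_rpow hl0] at this
    linarith
  have h2 : logWeight l ≤ 8 * (l : ℝ) ^ (-(7 / 8) : ℝ) := by
    unfold logWeight
    rw [div_le_iff₀ hl0, mul_assoc, ← Real.rpow_add_one hl0.ne']
    norm_num at h1 ⊢
    exact h1
  have h3 : (l : ℝ) = (sqrtPart l : ℝ) ^ 2 * sqfreePart l := by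
    exact_mod_cast (sqrtPart_sq_mul_sqfreePart l).symm
  calc _ ≤ 8 * (l : ℝ) ^ (-(7 / 8) : ℝ) / Real.sqrt (sqfreePart l) := by gcongr
    _ = _ := by
      conv_lhs => rw [h3]
      rw [Real.mul_rpow (by positivity) ha.le, ← Real.rpow_natCast_mul hb.le, div_eq_mul_inv,
        Real.sqrt_eq_rpow, ← Real.rpow_neg ha.le, mul_assoc, mul_assoc, ← Real.rpow_add ha]
      norm_num
      ring

lemma exists_sum_logWeight_div_sqrt_le : ∃ B : ℝ, 0 ≤ B ∧ ∀ N : ℕ,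
    ∑ l ∈ Ioc 0 N, logWeight l / Real.sqrt (sqfreePart l) ≤ B := by
  have s1 : Summable fun n : ℕ => (n : ℝ) ^ (-(11 / 8) : ℝ) :=
    Real.summable_nat_rpow.2 (by norm_num)
  have s2 : Summable fun n : ℕ => (n : ℝ) ^ (-(7 / 4) : ℝ) :=
    Real.summable_nat_rpow.2 (by norm_num)
  have s3 : Summable fun x : ℕ × ℕ => 8 * ((x.1 : ℝ) ^ (-(11 / 8) : ℝ) * (x.2 : ℝ) ^ (-(7 / 4) : ℝ)) :=
    (s1.mul_of_nonneg s2 (fun n => by positivity) (fun n => by positivity)).mul_left 8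
  refine ⟨∑' x : ℕ × ℕ, 8 * ((x.1 : ℝ) ^ (-(11 / 8) : ℝ) * (x.2 : ℝ) ^ (-(7 / 4) : ℝ)),
    tsum_nonneg fun x => by positivity, fun N => ?_⟩
  refine le_trans ?_ (s3.sum_le_tsum ((Ioc 0 N).image fun l => (sqfreePart l, sqrtPart l))
    (fun x _ => by positivity))
  rw [sum_image]
  · exact sum_le_sum fun l hl => logWeight_div_sqrt_le (mem_Ioc.1 hl).1
  · intro a _ b _ h
    simp only [Prod.mk.injEq] at h
    rw [← sqrtPart_sq_mul_sqfreePart a, ← sqrtPart_sq_mul_sqfreePart b, h.1, h.2]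

lemma sum_logKernel_common_le {l l' : ℕ} (hl : l ≠ 0) (hl' : l' ≠ 0) (N : ℕ) :
    ∑ k ∈ Ioc 0 N, (if l.primeFactors ⊆ k.primeFactors ∧ l'.primeFactors ⊆ k.primeFactors then
      logKernel N k else 0) ≤ 5 / (Real.sqrt (sqfreePart l) * Real.sqrt (sqfreePart l')) := by
  rw [← sum_filter]
  have ha := sqfreePart_pos l
  have ha' := sqfreePart_pos l'
  have hR : 0 < Nat.lcm (sqfreePart l) (sqfreePart l') := Nat.lcm_pos ha ha'
  have h1 := sum_logKernel_dvd_le hR N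
  rw [Nat.floor_natCast] at h1
  have ha1 : (0 : ℝ) < sqfreePart l := by exact_mod_cast ha
  have ha1' : (0 : ℝ) < sqfreePart l' := by exact_mod_cast ha'
  have h2 : Real.sqrt (sqfreePart l) * Real.sqrt (sqfreePart l') ≤
      (Nat.lcm (sqfreePart l) (sqfreePart l') : ℕ) := by
    rw [← Real.sqrt_mul ha1.le, Real.sqrt_le_left (by positivity), sq]
    gcongr
    · exact Nat.le_of_dvd hR (Nat.dvd_lcm_left _ _)
    · exact Nat.le_of_dvd hR (Nat.dvd_lcm_right _ _)
  calc _ ≤ ∑ k ∈ (Ioc 0 N).filter (fun k => Nat.lcm (sqfreePart l) (sqfreePart l') ∣ k),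
        logKernel N k := by
        refine sum_le_sum_of_subset_of_nonneg (fun k hk => ?_) fun k _ _ => logKernel_nonneg _ _
        simp only [mem_filter, mem_Ioc] at hk ⊢
        exact ⟨hk.1, Nat.lcm_dvd
          (sqfreePart_dvd_of_primeFactors_subset hl hk.2.1)
          (sqfreePart_dvd_of_primeFactors_subset hl' hk.2.2)⟩
    _ ≤ _ := h1
    _ ≤ _ := by gcongr

lemma exists_mobQuad_le : ∃ B : ℝ, 0 < B ∧ ∀ N : ℕ, mobQuad N ≤ B := by
  obtain ⟨C, hC, h⟩ := exists_abs_sum_mobDivCoprime_le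
  obtain ⟨V, hV, hV'⟩ := exists_sum_logWeight_div_sqrt_le
  refine ⟨C ^ 2 * (5 * V ^ 2) + 1, by positivity, fun N => (mobQuad_le N).trans ?_⟩
  have hk : ∀ k ∈ Ioc 0 N, 1 / (k : ℝ) * (∑ n ∈ Ioc 0 (N / k), mobDivCoprime k n) ^ 2 ≤
      C ^ 2 * (logKernel N k *
        (∑ l ∈ (Ioc 0 N).filter (fun l => l.primeFactors ⊆ k.primeFactors), logWeight l) ^ 2) := by
    intro k hk
    rw [mem_Ioc] at hk
    have hk0 : (0 : ℝ) < k := by exact_mod_cast hk.1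
    have h1 := h k hk.1.ne' ((N : ℝ) / k) (by rw [le_div_iff₀ hk0]; exact_mod_cast by simpa using hk.2)
    rw [Nat.floor_div_natCast, Nat.floor_natCast] at h1
    have h2 : ∑ l ∈ (Ioc 0 (N / k)).filter (fun l => l.primeFactors ⊆ k.primeFactors), logWeight l ≤
        ∑ l ∈ (Ioc 0 N).filter (fun l => l.primeFactors ⊆ k.primeFactors), logWeight l := by
      refine sum_le_sum_of_subset_of_nonneg (filter_subset_filter _
        (Ioc_subset_Ioc_right (Nat.div_le_self _ _))) fun l _ _ => logWeight_nonneg l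
    have h0 : 0 ≤ 1 + Real.log ((N : ℝ) / k) := by
      have : 0 ≤ Real.log ((N : ℝ) / k) := Real.log_nonneg
        (by rw [le_div_iff₀ hk0]; exact_mod_cast by simpa using hk.2)
      linarith
    have h3 := h1.trans (mul_le_mul_of_nonneg_left h2 (by positivity))
    have h4 := pow_le_pow_left₀ (abs_nonneg _) h3 2
    rw [sq_abs] at h4
    calc _ ≤ 1 / (k : ℝ) * (C * (1 + Real.log ((N : ℝ) / k)) ^ (-(3 / 4) : ℝ) *
          ∑ l ∈ (Ioc 0 N).filter (fun l => l.primeFactors ⊆ k.primeFactors), logWeight l) ^ 2 := by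
          gcongr
      _ = _ := by unfold logKernel; ring
  refine (sum_le_sum hk).trans ?_
  rw [← mul_sum]
  have hmain : ∑ k ∈ Ioc 0 N, logKernel N k *
        (∑ l ∈ (Ioc 0 N).filter (fun l => l.primeFactors ⊆ k.primeFactors), logWeight l) ^ 2 ≤
      5 * V ^ 2 := by
    have e : ∀ k ∈ Ioc 0 N, logKernel N k *
        (∑ l ∈ (Ioc 0 N).filter (fun l => l.primeFactors ⊆ k.primeFactors), logWeight l) ^ 2 =
        ∑ l ∈ Ioc 0 N, ∑ l' ∈ Ioc 0 N, logWeight l * logWeight l' *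
          (if l.primeFactors ⊆ k.primeFactors ∧ l'.primeFactors ⊆ k.primeFactors then
      logKernel N k else 0) := by
      intro k _
      rw [sum_filter, sq, sum_mul_sum, mul_sum]
      refine sum_congr rfl fun l _ => ?_
      rw [mul_sum]
      refine sum_congr rfl fun l' _ => ?_
      by_cases h1 : l.primeFactors ⊆ k.primeFactors <;>
        by_cases h2 : l'.primeFactors ⊆ k.primeFactors <;> simp [h1, h2]
      ring
    rw [sum_congr rfl e, sum_comm, sum_congr rfl fun l _ => sum_comm]
    calc _ ≤ ∑ l ∈ Ioc 0 N, ∑ l' ∈ Ioc 0 N, 5 * (logWeight l / Real.sqrt (sqfreePart l) *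
          (logWeight l' / Real.sqrt (sqfreePart l'))) := by
          refine sum_le_sum fun l hl => sum_le_sum fun l' hl' => ?_
          rw [← mul_sum]
          refine (mul_le_mul_of_nonneg_left (sum_logKernel_common_le (mem_Ioc.1 hl).1.ne'
            (mem_Ioc.1 hl').1.ne' N) (mul_nonneg (logWeight_nonneg _) (logWeight_nonneg _))).trans ?_
          apply le_of_eq
          rw [div_mul_div_comm]
          ring
      _ = 5 * (∑ l ∈ Ioc 0 N, logWeight l / Real.sqrt (sqfreePart l)) ^ 2 := by
          rw [sq, sum_mul_sum, mul_sum]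
          simp_rw [mul_sum]
      _ ≤ _ := by
          have := hV' N
          gcongr
          exact sum_nonneg fun l _ => div_nonneg (logWeight_nonneg _) (Real.sqrt_nonneg _)
  have : C ^ 2 * _ ≤ C ^ 2 * (5 * V ^ 2) := mul_le_mul_of_nonneg_left hmain (by positivity)
  linarith

/-- The sum of `μ(d)` over divisors `d ≤ Y` of `n` with `d * w < n`. -/
noncomputable def mobDivisorSum (w : ℝ) (Y n : ℕ) : ℝ :=
  ∑ d ∈ Ioc 0 Y, if d ∣ n ∧ (d : ℝ) * w < n then (ArithmeticFunction.moebius d : ℝ) else 0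

lemma abs_card_dvd_sub_le {l : ℕ} (hl : 0 < l) {w x : ℝ} (hw : 0 ≤ w) (hwx : w ≤ x) :
    |(#{n ∈ Ioc 0 ⌊x⌋₊ | l ∣ n ∧ w < n} : ℝ) - (x - w) / l| ≤ 1 := by
  have hx : 0 ≤ x := hw.trans hwx
  have hl0 : (0 : ℝ) < l := by exact_mod_cast hl
  have h1 : #{n ∈ Ioc 0 ⌊x⌋₊ | l ∣ n ∧ w < n} + #{n ∈ Ioc 0 ⌊w⌋₊ | l ∣ n} =
      #{n ∈ Ioc 0 ⌊x⌋₊ | l ∣ n} := by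
    rw [← card_union_of_disjoint]
    · congr 1
      ext n
      simp only [mem_union, mem_filter, mem_Ioc, Nat.le_floor_iff hx, Nat.le_floor_iff hw]
      constructor
      · rintro (h | h)
        · exact ⟨h.1, h.2.1⟩
        · exact ⟨⟨h.1.1, h.1.2.trans hwx⟩, h.2⟩
      · intro h
        by_cases h' : w < n
        · exact Or.inl ⟨h.1, h.2, h'⟩
        · exact Or.inr ⟨⟨h.1.1, not_lt.1 h'⟩, h.2⟩
    · rw [disjoint_left]
      intro n hn hn'
      simp only [mem_filter, mem_Ioc, Nat.le_floor_iff hw] at hn hn'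
      exact absurd hn'.1.2 (not_le.2 hn.2.2)
  rw [Nat.Ioc_filter_dvd_card_eq_div, Nat.Ioc_filter_dvd_card_eq_div, ← Nat.floor_div_natCast,
    ← Nat.floor_div_natCast] at h1
  have h2 : (#{n ∈ Ioc 0 ⌊x⌋₊ | l ∣ n ∧ w < n} : ℝ) = (⌊x / l⌋₊ : ℝ) - ⌊w / l⌋₊ := by
    rw [eq_sub_iff_add_eq]
    exact_mod_cast h1
  have a1 := Nat.floor_le (div_nonneg hx hl0.le)
  have a2 := Nat.floor_le (div_nonneg hw hl0.le)
  have a3 := Nat.lt_floor_add_one (x / l)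
  have a4 := Nat.lt_floor_add_one (w / l)
  rw [h2, sub_div, abs_le]
  constructor <;> linarith

lemma sum_mobDivisorSum_sq_eq {w : ℝ} (hw : 0 ≤ w) (Y X : ℕ) :
    ∑ n ∈ Ioc 0 X, mobDivisorSum w Y n ^ 2 =
      ∑ d ∈ Ioc 0 Y, ∑ e ∈ Ioc 0 Y,
        (ArithmeticFunction.moebius d : ℝ) * ArithmeticFunction.moebius e *
          #{n ∈ Ioc 0 X | Nat.lcm d e ∣ n ∧ max (d : ℝ) e * w < n} := by
  have e1 : ∀ n ∈ Ioc 0 X, mobDivisorSum w Y n ^ 2 = ∑ d ∈ Ioc 0 Y, ∑ e ∈ Ioc 0 Y,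
        (ArithmeticFunction.moebius d : ℝ) * ArithmeticFunction.moebius e *
          (if (d ∣ n ∧ (d : ℝ) * w < n) ∧ (e ∣ n ∧ (e : ℝ) * w < n) then 1 else 0) := by
    intro n _
    rw [mobDivisorSum, sq, sum_mul_sum]
    refine sum_congr rfl fun d _ => sum_congr rfl fun e _ => ?_
    by_cases h1 : d ∣ n ∧ (d : ℝ) * w < n <;> by_cases h2 : e ∣ n ∧ (e : ℝ) * w < n <;>
      simp [h1, h2]
  rw [sum_congr rfl e1, sum_comm]
  refine sum_congr rfl fun d _ => ?_
  rw [sum_comm]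
  refine sum_congr rfl fun e _ => ?_
  rw [← mul_sum, card_filter]
  push_cast
  congr 1
  refine sum_congr rfl fun n _ => ?_
  congr 1
  rw [Nat.lcm_dvd_iff, eq_iff_iff]
  rw [max_mul_of_nonneg _ _ hw, max_lt_iff]
  tauto

lemma sub_max_eq_sum {d e Y : ℕ} (hd : d ≤ Y) (he : e ≤ Y) :
    (Y : ℝ) - max (d : ℝ) e = ∑ j ∈ range Y, if d ≤ j ∧ e ≤ j then (1 : ℝ) else 0 := by
  have h : (range Y).filter (fun j => d ≤ j ∧ e ≤ j) = Ico (max d e) Y := by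
    ext j
    simp only [mem_filter, mem_range, mem_Ico, max_le_iff]
    tauto
  rw [← sum_filter, h, sum_const, Nat.card_Ico, nsmul_one, Nat.cast_sub (max_le hd he)]
  push_cast
  rfl

lemma mobQuad_eq_sum_ite {j Y : ℕ} (hj : j ≤ Y) :
    mobQuad j = ∑ d ∈ Ioc 0 Y, ∑ e ∈ Ioc 0 Y,
      (ArithmeticFunction.moebius d : ℝ) * ArithmeticFunction.moebius e / (Nat.lcm d e : ℝ) *
        (if d ≤ j ∧ e ≤ j then (1 : ℝ) else 0) := by
  have h : Ioc 0 j = (Ioc 0 Y).filter (fun d => d ≤ j) := by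
    ext d
    simp only [mem_filter, mem_Ioc]
    omega
  rw [mobQuad, h, sum_filter]
  refine sum_congr rfl fun d _ => ?_
  rw [sum_filter]
  by_cases hd : d ≤ j
  · rw [if_pos hd]
    refine sum_congr rfl fun e _ => ?_
    by_cases he : e ≤ j <;> simp [hd, he]
  · simp [hd]

lemma sum_moebius_sub_max_le {B : ℝ} (hB : ∀ N, mobQuad N ≤ B) {w x : ℝ} (hw : 0 ≤ w) {Y : ℕ}
    (hwx : Y * w ≤ x) :
    ∑ d ∈ Ioc 0 Y, ∑ e ∈ Ioc 0 Y,
      (ArithmeticFunction.moebius d : ℝ) * ArithmeticFunction.moebius e *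
        ((x - max (d : ℝ) e * w) / (Nat.lcm d e : ℝ)) ≤ x * B := by
  have h : ∑ d ∈ Ioc 0 Y, ∑ e ∈ Ioc 0 Y,
      (ArithmeticFunction.moebius d : ℝ) * ArithmeticFunction.moebius e *
        ((x - max (d : ℝ) e * w) / (Nat.lcm d e : ℝ)) =
      (x - Y * w) * mobQuad Y + w * ∑ j ∈ range Y, mobQuad j := by
    rw [sum_congr rfl fun j hj => mobQuad_eq_sum_ite (mem_range.1 hj).le,
      sum_comm (s := range Y), mobQuad, mul_sum, mul_sum, ← sum_add_distrib]
    refine sum_congr rfl fun d hd => ?_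
    rw [sum_comm (s := range Y), mul_sum, mul_sum, ← sum_add_distrib]
    refine sum_congr rfl fun e he => ?_
    rw [← mul_sum, ← sub_max_eq_sum (mem_Ioc.1 hd).2 (mem_Ioc.1 he).2]
    ring
  rw [h]
  have h1 : ∑ j ∈ range Y, mobQuad j ≤ Y * B := by
    simpa using sum_le_card_nsmul (range Y) mobQuad B fun j _ => hB j
  have h2 := mul_le_mul_of_nonneg_left (hB Y) (sub_nonneg.2 hwx)
  have h3 := mul_le_mul_of_nonneg_left h1 hw
  linarith

lemma sum_mobDivisorSum_sq_le {B : ℝ} (hB : ∀ N, mobQuad N ≤ B) {w x : ℝ} (hw : 0 ≤ w) {Y : ℕ}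
    (hwx : Y * w ≤ x) :
    ∑ n ∈ Ioc 0 ⌊x⌋₊, mobDivisorSum w Y n ^ 2 ≤ x * B + (Y : ℝ) ^ 2 := by
  rw [sum_mobDivisorSum_sq_eq hw]
  calc _ ≤ ∑ d ∈ Ioc 0 Y, ∑ e ∈ Ioc 0 Y,
      ((ArithmeticFunction.moebius d : ℝ) * ArithmeticFunction.moebius e *
        ((x - max (d : ℝ) e * w) / (Nat.lcm d e : ℝ)) + 1) := by
        refine sum_le_sum fun d hd => sum_le_sum fun e he => ?_
        rw [mem_Ioc] at hd he
        have hm : max (d : ℝ) e ≤ Y := max_le (by exact_mod_cast hd.2) (by exact_mod_cast he.2)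
        have h1 := abs_card_dvd_sub_le (Nat.lcm_pos hd.1 he.1) (w := max (d : ℝ) e * w) (x := x)
          (by positivity) ((mul_le_mul_of_nonneg_right hm hw).trans hwx)
        have h2 : |(ArithmeticFunction.moebius d : ℝ) * ArithmeticFunction.moebius e| ≤ 1 := by
          rw [abs_mul]
          exact mul_le_one₀ (abs_moebius_le_one_real d) (abs_nonneg _) (abs_moebius_le_one_real e)
        have h3 := (le_abs_self _).trans ((abs_mul _ _).trans_le
          (mul_le_one₀ h2 (abs_nonneg _) h1))
        rw [mul_sub] at h3
        linarith
    _ = ∑ d ∈ Ioc 0 Y, ∑ e ∈ Ioc 0 Y,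
        (ArithmeticFunction.moebius d : ℝ) * ArithmeticFunction.moebius e *
          ((x - max (d : ℝ) e * w) / (Nat.lcm d e : ℝ)) + (Y : ℝ) ^ 2 := by
        simp_rw [sum_add_distrib]
        simp [sq]
    _ ≤ _ := by
        gcongr
        exact sum_moebius_sub_max_le hB hw hwx

/-- The sum of `μ(d)` over divisors `d ≤ z` of `n`, as a real number. -/
noncomputable def truncMobSum (n : ℕ) (z : ℝ) : ℝ :=
  ∑ d ∈ n.divisors.filter (fun d : ℕ => (d : ℝ) ≤ z), (ArithmeticFunction.moebius d : ℝ)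

lemma truncMobSum_eq_zero_of_lt_one {n : ℕ} {z : ℝ} (hz : z < 1) : truncMobSum n z = 0 := by
  rw [truncMobSum, filter_eq_empty_iff.2, sum_empty]
  intro d hd
  have : (1 : ℝ) ≤ d := by exact_mod_cast Nat.pos_of_mem_divisors hd
  linarith

lemma truncMobSum_one_sq_le (z : ℝ) : truncMobSum 1 z ^ 2 ≤ 1 := by
  by_cases h : (1 : ℝ) ≤ z <;> simp [truncMobSum, filter_singleton, h]

lemma truncMobSum_eq_mobDivisorSum {n : ℕ} (hn : 0 < n) {z : ℝ} (hz : 0 ≤ z) :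
    truncMobSum n z = mobDivisorSum 0 ⌊z⌋₊ n := by
  rw [truncMobSum, mobDivisorSum, ← sum_filter]
  refine sum_congr ?_ fun _ _ => rfl
  ext d
  simp only [mem_filter, Nat.mem_divisors, mem_Ioc, Nat.le_floor_iff hz, mul_zero, Nat.cast_pos]
  constructor
  · rintro ⟨h, h'⟩
    exact ⟨⟨Nat.pos_of_dvd_of_pos h.1 hn, h'⟩, h.1, hn⟩
  · rintro ⟨h, h'⟩
    exact ⟨⟨h'.1, hn.ne'⟩, h.2⟩

lemma truncMobSum_sq_eq_of_squarefree {n : ℕ} (hn : Squarefree n) (hn1 : n ≠ 1) {x z : ℝ}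
    (hz : 0 < z) (hnx : (n : ℝ) ≤ x) :
    truncMobSum n z ^ 2 = mobDivisorSum z ⌊x / z⌋₊ n ^ 2 := by
  have hn0 : 0 < n := Nat.pos_of_ne_zero hn.ne_zero
  have hx : 0 ≤ x := n.cast_nonneg.trans hnx
  have h0 : ∑ d ∈ n.divisors, (ArithmeticFunction.moebius d : ℝ) = 0 := by
    have h := congrArg (fun f : ArithmeticFunction ℤ => f n) ArithmeticFunction.coe_zeta_mul_moebius
    simp only [ArithmeticFunction.coe_zeta_mul_apply, ArithmeticFunction.one_apply_ne hn1] at h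
    exact_mod_cast h
  have h1 : truncMobSum n z =
      -∑ d ∈ n.divisors.filter (fun d : ℕ => ¬ (d : ℝ) ≤ z), (ArithmeticFunction.moebius d : ℝ) := by
    rw [truncMobSum, eq_neg_iff_add_eq_zero, sum_filter_add_sum_filter_not, h0]
  have h2 : ∑ d ∈ n.divisors.filter (fun d : ℕ => ¬ (d : ℝ) ≤ z),
      (ArithmeticFunction.moebius d : ℝ) =
      ArithmeticFunction.moebius n * mobDivisorSum z ⌊x / z⌋₊ n := by
    rw [mobDivisorSum, ← sum_filter, mul_sum]
    refine sum_nbij' (fun d => n / d) (fun d => n / d) ?_ ?_ ?_ ?_ ?_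
    · intro d hd
      simp only [mem_filter, Nat.mem_divisors, mem_Ioc, not_le] at hd ⊢
      obtain ⟨⟨⟨k, rfl⟩, -⟩, hd⟩ := hd
      have hd0 : 0 < d := Nat.pos_of_mul_pos_right hn0
      have hk0 : (0 : ℝ) < k := by exact_mod_cast Nat.pos_of_mul_pos_left hn0
      push_cast at *
      rw [Nat.mul_div_cancel_left _ hd0, Nat.le_floor_iff (by positivity), le_div_iff₀ hz]
      have : (k : ℝ) * z < d * k := by rw [mul_comm]; gcongr
      exact ⟨⟨Nat.pos_of_mul_pos_left hn0, this.le.trans hnx⟩, Dvd.intro_left _ rfl, this⟩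
    · intro d hd
      simp only [mem_filter, Nat.mem_divisors, mem_Ioc, not_le] at hd ⊢
      obtain ⟨-, ⟨k, rfl⟩, hd⟩ := hd
      have hd0 : 0 < d := Nat.pos_of_mul_pos_right hn0
      push_cast at hd
      rw [Nat.mul_div_cancel_left _ hd0]
      exact ⟨⟨Dvd.intro_left _ rfl, hn0.ne'⟩, lt_of_mul_lt_mul_left hd d.cast_nonneg⟩
    · intro d hd
      simp only [mem_filter, Nat.mem_divisors] at hd
      exact Nat.div_div_self hd.1.1 hn0.ne'
    · intro d hd
      simp only [mem_filter] at hd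
      exact Nat.div_div_self hd.2.1 hn0.ne'
    · intro d hd
      simp only [mem_filter, Nat.mem_divisors] at hd
      obtain ⟨⟨⟨k, rfl⟩, -⟩, -⟩ := hd
      have hd0 : 0 < d := Nat.pos_of_mul_pos_right hn0
      rw [Nat.mul_div_cancel_left _ hd0,
        ArithmeticFunction.isMultiplicative_moebius.map_mul_of_coprime
          (Nat.coprime_of_squarefree_mul hn)]
      have : (ArithmeticFunction.moebius k : ℝ) * ArithmeticFunction.moebius k = 1 := by
        rw [← sq]
        exact_mod_cast ArithmeticFunction.moebius_sq_eq_one_of_squarefree hn.of_mul_right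
      push_cast
      rw [mul_assoc, this, mul_one]
  have h3 : (ArithmeticFunction.moebius n : ℝ) ^ 2 = 1 := by
    exact_mod_cast ArithmeticFunction.moebius_sq_eq_one_of_squarefree hn
  rw [h1, h2, neg_sq, mul_pow, h3, one_mul]

lemma exists_sum_squarefree_truncMobSum_sq_le : ∃ C : ℝ, 0 < C ∧ ∀ x z : ℝ, 0 ≤ x →
    ∑ n ∈ (Ioc 0 ⌊x⌋₊).filter Squarefree, truncMobSum n z ^ 2 ≤ C * x := by
  obtain ⟨B, hB, hB'⟩ := exists_mobQuad_le
  refine ⟨B + 2, by positivity, fun x z hx => ?_⟩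
  rcases lt_or_ge z 1 with hz | hz
  · rw [sum_eq_zero fun n _ => by rw [truncMobSum_eq_zero_of_lt_one hz, sq, zero_mul]]
    positivity
  rcases lt_or_ge x 1 with hx1 | hx1
  · rw [Nat.floor_eq_zero.2 hx1]
    simp only [Ioc_self, filter_empty, sum_empty]
    positivity
  have hz0 : 0 < z := by linarith
  rcases le_total (z ^ 2) x with h | h
  · have h1 := sum_mobDivisorSum_sq_le hB' (w := 0) (x := x) le_rfl (Y := ⌊z⌋₊) (by simpa using hx)
    have h2 : (⌊z⌋₊ : ℝ) ^ 2 ≤ x := (pow_le_pow_left₀ (by positivity) (Nat.floor_le hz0.le) 2).trans h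
    calc _ ≤ ∑ n ∈ Ioc 0 ⌊x⌋₊, truncMobSum n z ^ 2 :=
          sum_le_sum_of_subset_of_nonneg (filter_subset _ _) fun n _ _ => sq_nonneg _
      _ = ∑ n ∈ Ioc 0 ⌊x⌋₊, mobDivisorSum 0 ⌊z⌋₊ n ^ 2 :=
          sum_congr rfl fun n hn => by
            rw [truncMobSum_eq_mobDivisorSum (mem_Ioc.1 hn).1 hz0.le]
      _ ≤ _ := by linarith
  · have h0 : (⌊x / z⌋₊ : ℝ) ≤ x / z := Nat.floor_le (by positivity)
    have h1 := sum_mobDivisorSum_sq_le hB' (w := z) (x := x) hz0.le (Y := ⌊x / z⌋₊)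
      (by rwa [← le_div_iff₀ hz0])
    have h2 : (⌊x / z⌋₊ : ℝ) ^ 2 ≤ x := by
      refine (pow_le_pow_left₀ (by positivity) h0 2).trans ?_
      rw [div_pow, div_le_iff₀ (by positivity), sq]
      gcongr
    calc _ ≤ ∑ n ∈ (Ioc 0 ⌊x⌋₊).filter Squarefree,
          (mobDivisorSum z ⌊x / z⌋₊ n ^ 2 + if n = 1 then 1 else 0) := by
          refine sum_le_sum fun n hn => ?_
          simp only [mem_filter, mem_Ioc, Nat.le_floor_iff hx] at hn
          by_cases hn1 : n = 1
          · subst hn1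
            rw [if_pos rfl]
            have := truncMobSum_one_sq_le z
            have := sq_nonneg (mobDivisorSum z ⌊x / z⌋₊ 1)
            linarith
          · rw [if_neg hn1, add_zero, truncMobSum_sq_eq_of_squarefree hn.2 hn1 hz0 hn.1.2]
      _ ≤ ∑ n ∈ Ioc 0 ⌊x⌋₊, (mobDivisorSum z ⌊x / z⌋₊ n ^ 2 + if n = 1 then 1 else 0) :=
          sum_le_sum_of_subset_of_nonneg (filter_subset _ _) fun n _ _ => by positivity
      _ ≤ ∑ n ∈ Ioc 0 ⌊x⌋₊, mobDivisorSum z ⌊x / z⌋₊ n ^ 2 + 1 := by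
          rw [sum_add_distrib, sum_ite_eq']
          gcongr
          split_ifs <;> simp
      _ ≤ _ := by linarith

lemma truncMobSum_radical {n : ℕ} (hn : n ≠ 0) (z : ℝ) :
    truncMobSum (UniqueFactorizationMonoid.radical n) z = truncMobSum n z := by
  refine sum_subset (filter_subset_filter _ (Nat.divisors_subset_of_dvd hn
    UniqueFactorizationMonoid.radical_dvd_self)) fun d hd hd' => ?_
  rw [ArithmeticFunction.moebius_eq_zero_of_not_squarefree, Int.cast_zero]
  intro h
  simp only [mem_filter, Nat.mem_divisors] at hd hd'
  exact hd' ⟨⟨(UniqueFactorizationMonoid.dvd_radical_iff h.isRadical hn).2 hd.1.1,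
    UniqueFactorizationMonoid.radical_ne_zero⟩, hd.2⟩

lemma truncMobSum_mul {r q : ℕ} (h : r.Coprime q) (z : ℝ) :
    truncMobSum (r * q) z =
      ∑ d ∈ r.divisors, (ArithmeticFunction.moebius d : ℝ) * truncMobSum q (z / d) := by
  rw [truncMobSum, sum_filter, Nat.divisors_mul, mul_def, sum_image h.mul_injOn_divisors,
    sum_product]
  refine sum_congr rfl fun d hd => ?_
  rw [truncMobSum, sum_filter, mul_sum]
  refine sum_congr rfl fun e he => ?_
  have hd0 : (0 : ℝ) < d := by exact_mod_cast Nat.pos_of_mem_divisors hd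
  have hde : d.Coprime e := (h.coprime_dvd_left (Nat.dvd_of_mem_divisors hd)).coprime_dvd_right
    (Nat.dvd_of_mem_divisors he)
  simp only [le_div_iff₀ hd0, mul_ite, mul_zero,
    ArithmeticFunction.isMultiplicative_moebius.map_mul_of_coprime hde]
  push_cast
  simp only [mul_comm (d : ℝ) e]

lemma truncMobSum_mul_sq_le {r q : ℕ} (h : r.Coprime q) (z : ℝ) :
    truncMobSum (r * q) z ^ 2 ≤ #r.divisors * ∑ d ∈ r.divisors, truncMobSum q (z / d) ^ 2 := by
  rw [truncMobSum_mul h]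
  refine sq_sum_le_card_mul_sum_sq.trans ?_
  refine mul_le_mul_of_nonneg_left (sum_le_sum fun d _ => ?_) (Nat.cast_nonneg _)
  rw [mul_pow]
  refine mul_le_of_le_one_left (sq_nonneg _) ?_
  rw [sq_le_one_iff_abs_le_one]
  exact abs_moebius_le_one_real d

lemma card_divisors_sq_le_of_squarefree {r : ℕ} (h : Squarefree r) :
    (#r.divisors : ℝ) ^ 2 ≤ 4 ^ 16 * Real.sqrt r := by
  have h1 : #r.divisors = ∏ p ∈ r.primeFactors, 2 := by
    rw [Nat.card_divisors h.ne_zero]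
    refine prod_congr rfl fun p hp => ?_
    rw [Nat.mem_primeFactors] at hp
    rw [le_antisymm (h.natFactorization_le_one p) (hp.1.factorization_pos_of_dvd hp.2.2 hp.2.1)]
  have h2 : Real.sqrt r = ∏ p ∈ r.primeFactors, Real.sqrt p := by
    conv_lhs => rw [← Nat.prod_primeFactors_of_squarefree h]
    push_cast
    rw [Real.sqrt_eq_rpow, ← Real.finsetProd_rpow _ _ fun p _ => p.cast_nonneg]
    simp_rw [Real.sqrt_eq_rpow]
  have h3 : (#r.divisors : ℝ) ^ 2 = ∏ p ∈ r.primeFactors, 4 := by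
    rw [h1]
    push_cast
    rw [← prod_pow]
    norm_num
  have h4 : ∏ p ∈ r.primeFactors, (if p < 16 then (4 : ℝ) else 1) ≤ 4 ^ 16 := by
    rw [← prod_filter, prod_const]
    refine pow_le_pow_right₀ (by norm_num) ?_
    calc _ ≤ #(range 16) := card_le_card fun p hp => by
          rw [mem_filter] at hp
          exact mem_range.2 hp.2
      _ = 16 := card_range 16
  rw [h3, h2]
  calc _ ≤ ∏ p ∈ r.primeFactors, ((if p < 16 then (4 : ℝ) else 1) * Real.sqrt p) := by
        refine prod_le_prod (fun _ _ => by norm_num) fun p hp => ?_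
        have hp1 : 1 ≤ p := (Nat.prime_of_mem_primeFactors hp).one_le
        split_ifs with h16
        · have : 1 ≤ Real.sqrt p := Real.one_le_sqrt.2 (by exact_mod_cast hp1)
          linarith
        · rw [one_mul]
          refine Real.le_sqrt_of_sq_le ?_
          norm_num
          exact_mod_cast not_lt.1 h16
    _ = _ := prod_mul_distrib
    _ ≤ _ := by gcongr

/-- The weight with which the factor `m = n / radical n` contributes. -/
noncomputable def radicalWeight (m : ℕ) : ℝ :=
  (#(UniqueFactorizationMonoid.radical m).divisors : ℝ) ^ 2 /
    (m * UniqueFactorizationMonoid.radical m : ℕ)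

lemma radicalWeight_le {m : ℕ} (hm : 0 < m) : radicalWeight m ≤
    4 ^ 16 * ((sqfreePart m : ℝ) ^ (-(3 / 2) : ℝ) * (sqrtPart m : ℝ) ^ (-2 : ℝ)) := by
  set r := UniqueFactorizationMonoid.radical m with hr
  have ha : (0 : ℝ) < sqfreePart m := by exact_mod_cast sqfreePart_pos m
  have hb : (0 : ℝ) < sqrtPart m := by exact_mod_cast sqrtPart_pos hm
  have hr0 : (0 : ℝ) < r := by exact_mod_cast Nat.radical_pos m
  have hm0 : (0 : ℝ) < m := by exact_mod_cast hm
  have har : (sqfreePart m : ℝ) ≤ r := by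
    exact_mod_cast Nat.le_of_dvd (Nat.radical_pos m)
      (sqfreePart_dvd_of_primeFactors_subset hm.ne' (Nat.primeFactors_radical m).ge)
  have h1 := card_divisors_sq_le_of_squarefree
    (UniqueFactorizationMonoid.squarefree_radical (a := m))
  have h3 : (m : ℝ) = (sqrtPart m : ℝ) ^ 2 * sqfreePart m := by
    exact_mod_cast (sqrtPart_sq_mul_sqfreePart m).symm
  unfold radicalWeight
  rw [← hr] at h1 ⊢
  push_cast
  calc _ ≤ 4 ^ 16 * Real.sqrt r / (m * r) := by gcongr
    _ = 4 ^ 16 * (1 / (m * Real.sqrt r)) := by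
        have : Real.sqrt r * Real.sqrt r = r := Real.mul_self_sqrt hr0.le
        have hs : 0 < Real.sqrt r := Real.sqrt_pos.2 hr0
        conv_lhs => rw [← this, Real.sqrt_mul_self hs.le]
        field_simp
    _ ≤ 4 ^ 16 * (1 / (m * Real.sqrt (sqfreePart m))) := by gcongr
    _ = _ := by
        congr 1
        rw [h3, Real.sqrt_eq_rpow, Real.rpow_neg ha.le, Real.rpow_neg hb.le, ← mul_inv, one_div,
          mul_assoc, ← Real.rpow_one_add' ha.le (by norm_num)]
        norm_num
        ring

lemma exists_sum_radicalWeight_le : ∃ B : ℝ, 0 ≤ B ∧ ∀ N : ℕ,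
    ∑ m ∈ Ioc 0 N, radicalWeight m ≤ B := by
  have s1 : Summable fun n : ℕ => (n : ℝ) ^ (-(3 / 2) : ℝ) :=
    Real.summable_nat_rpow.2 (by norm_num)
  have s2 : Summable fun n : ℕ => (n : ℝ) ^ (-2 : ℝ) :=
    Real.summable_nat_rpow.2 (by norm_num)
  have s3 : Summable fun x : ℕ × ℕ => 4 ^ 16 * ((x.1 : ℝ) ^ (-(3 / 2) : ℝ) * (x.2 : ℝ) ^ (-2 : ℝ)) :=
    (s1.mul_of_nonneg s2 (fun n => by positivity) (fun n => by positivity)).mul_left (4 ^ 16)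
  refine ⟨∑' x : ℕ × ℕ, 4 ^ 16 * ((x.1 : ℝ) ^ (-(3 / 2) : ℝ) * (x.2 : ℝ) ^ (-2 : ℝ)),
    tsum_nonneg fun x => by positivity, fun N => ?_⟩
  refine le_trans ?_ (s3.sum_le_tsum ((Ioc 0 N).image fun l => (sqfreePart l, sqrtPart l))
    (fun x _ => by positivity))
  rw [sum_image]
  · exact sum_le_sum fun l hl => radicalWeight_le (mem_Ioc.1 hl).1
  · intro a _ b _ h
    simp only [Prod.mk.injEq] at h
    rw [← sqrtPart_sq_mul_sqfreePart a, ← sqrtPart_sq_mul_sqfreePart b, h.1, h.2]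

lemma exists_eq_mul_radical_mul {n : ℕ} (hn : n ≠ 0) : ∃ m q : ℕ, m ≠ 0 ∧ Squarefree q ∧
    (UniqueFactorizationMonoid.radical m).Coprime q ∧
    m * UniqueFactorizationMonoid.radical m * q = n ∧
    UniqueFactorizationMonoid.radical n = UniqueFactorizationMonoid.radical m * q := by
  obtain ⟨m, hm⟩ := UniqueFactorizationMonoid.radical_dvd_self (a := n)
  have hmn : m ∣ n := Dvd.intro_left _ hm.symm
  obtain ⟨q, hq⟩ := UniqueFactorizationMonoid.radical_dvd_radical hmn hn
  have hs : Squarefree (UniqueFactorizationMonoid.radical m * q) :=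
    hq ▸ UniqueFactorizationMonoid.squarefree_radical
  refine ⟨m, q, ?_, hs.of_mul_right, Nat.coprime_of_squarefree_mul hs, ?_, hq⟩
  · rintro rfl
    simp at hm
    exact hn hm
  · rw [mul_assoc, ← hq, mul_comm, ← hm]

lemma exists_sum_truncMobSum_sq_le : ∃ C : ℝ, 0 < C ∧ ∀ x z : ℝ, 0 ≤ x →
    ∑ n ∈ Ioc 0 ⌊x⌋₊, truncMobSum n z ^ 2 ≤ C * x := by
  obtain ⟨C, hC, h⟩ := exists_sum_squarefree_truncMobSum_sq_le
  obtain ⟨B, hB, hB'⟩ := exists_sum_radicalWeight_le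
  refine ⟨C * B + 1, by positivity, fun x z hx => ?_⟩
  choose! m q hm hq hc he hr using fun n : ℕ => exists_eq_mul_radical_mul (n := n)
  set r : ℕ → ℕ := fun m => UniqueFactorizationMonoid.radical m with hrdef
  have hr0 : ∀ k, 0 < r k := Nat.radical_pos
  set S : Finset (Σ _ : ℕ, ℕ) := (Ioc 0 ⌊x⌋₊).sigma fun k =>
    (Ioc 0 ⌊x / (k * r k : ℕ)⌋₊).filter Squarefree
  have hle : ∀ n ∈ Ioc 0 ⌊x⌋₊, truncMobSum n z ^ 2 ≤
      #(r (m n)).divisors * ∑ d ∈ (r (m n)).divisors, truncMobSum (q n) (z / d) ^ 2 := by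
    intro n hn
    have hn0 := (mem_Ioc.1 hn).1.ne'
    rw [← truncMobSum_radical hn0, hr n hn0]
    exact truncMobSum_mul_sq_le (hc n hn0) z
  have hmaps : (Ioc 0 ⌊x⌋₊).image (fun n => (⟨m n, q n⟩ : Σ _ : ℕ, ℕ)) ⊆ S := by
    intro p hp
    obtain ⟨n, hn, rfl⟩ := mem_image.1 hp
    rw [mem_Ioc, Nat.le_floor_iff hx] at hn
    have hn0 := hn.1.ne'
    have hq0 : 0 < q n := Nat.pos_of_ne_zero (hq n hn0).ne_zero
    have hm0 : 0 < m n := Nat.pos_of_ne_zero (hm n hn0)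
    have hprod : 0 < m n * r (m n) := Nat.mul_pos hm0 (hr0 _)
    have hprod' : (0 : ℝ) < (m n * r (m n) : ℕ) := by exact_mod_cast hprod
    have hmn : (m n : ℝ) ≤ n := by
      exact_mod_cast Nat.le_of_dvd hn.1 (Dvd.intro _ ((mul_assoc _ _ _).symm.trans (he n hn0)))
    simp only [S, mem_sigma, mem_filter, mem_Ioc, Nat.le_floor_iff hx]
    refine ⟨⟨hm0, hmn.trans hn.2⟩, ⟨hq0, ?_⟩, hq n hn0⟩
    rw [Nat.le_floor_iff (by positivity), le_div_iff₀ hprod']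
    refine le_trans (le_of_eq ?_) hn.2
    rw [mul_comm]
    exact_mod_cast he n hn0
  have hinj : Set.InjOn (fun n => (⟨m n, q n⟩ : Σ _ : ℕ, ℕ)) (Ioc 0 ⌊x⌋₊ : Finset ℕ) := by
    intro a ha b hb hab
    have ha0 := (mem_Ioc.1 (mem_coe.1 ha)).1.ne'
    have hb0 := (mem_Ioc.1 (mem_coe.1 hb)).1.ne'
    simp only [Sigma.mk.injEq, heq_eq_eq] at hab
    rw [← he a ha0, ← he b hb0, hab.1, hab.2]
  have hbound : ∑ n ∈ Ioc 0 ⌊x⌋₊, truncMobSum n z ^ 2 ≤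
      ∑ p ∈ S, #(r p.1).divisors * ∑ d ∈ (r p.1).divisors, truncMobSum p.2 (z / d) ^ 2 := by
    refine (sum_le_sum hle).trans ?_
    rw [← sum_image (f := fun p : (Σ _ : ℕ, ℕ) => (#(r p.1).divisors : ℝ) *
      ∑ d ∈ (r p.1).divisors, truncMobSum p.2 (z / d) ^ 2) hinj]
    exact sum_le_sum_of_subset_of_nonneg hmaps fun p _ _ => by positivity
  refine hbound.trans ?_
  rw [sum_sigma]
  calc _ ≤ ∑ k ∈ Ioc 0 ⌊x⌋₊, C * x * radicalWeight k := by
        refine sum_le_sum fun k hk => ?_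
        dsimp only
        rw [← mul_sum, sum_comm]
        have hk0 := (mem_Ioc.1 hk).1
        have h1 : ∑ d ∈ (r k).divisors, ∑ n ∈ (Ioc 0 ⌊x / (k * r k : ℕ)⌋₊).filter Squarefree,
            truncMobSum n (z / d) ^ 2 ≤ #(r k).divisors * (C * (x / (k * r k : ℕ))) := by
          rw [← nsmul_eq_mul]
          exact sum_le_card_nsmul _ _ _ fun d _ => h _ _ (by positivity)
        refine (mul_le_mul_of_nonneg_left h1 (Nat.cast_nonneg _)).trans (le_of_eq ?_)
        simp only [radicalWeight, hrdef]
        ring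
    _ = C * x * ∑ k ∈ Ioc 0 ⌊x⌋₊, radicalWeight k := by rw [mul_sum]
    _ ≤ C * x * B := mul_le_mul_of_nonneg_left (hB' _) (by positivity)
    _ ≤ _ := by linarith

end TruncatedMobius

theorem stmt1 :
    ∃ C > (0 : ℝ), ∀ x z : ℝ, 1 ≤ x → 1 ≤ z → Ssum x z ≤ C * x := by
  obtain ⟨C, hC, h⟩ := TruncatedMobius.exists_sum_truncMobSum_sq_le
  refine ⟨C, hC, fun x z hx _ => le_trans (le_of_eq ?_) (h x z (by linarith))⟩
  unfold Ssum
  refine sum_congr rfl fun n _ => ?_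
  rw [mobM, TruncatedMobius.truncMobSum]
  push_cast
  rfl
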